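/- (Corollary 3.8, weak geometric lemma) Let f : 𝕎 → ℍ be an M-bilipschitz map, M ≥ 1. For every ε ∈ (0,1] and C ≥ 1 there exists a constant C'' > 0, depending only on C, ε and M, such that Σ_{Q ∈ 𝒟, Q ⊂ Q₀, β_f(CQ) ≥ ε} ℓ(Q)³ ≤ C''·ℓ(Q₀)³ for every Q₀ ∈ 𝒟. -/

import Mathlib

open scoped ENNReal

namespace HeisRug

/-- The first Heisenberg group, as a set: ℝ³. -/
abbrev Hei : Type := ℝ × ℝ × ℝ

/-- Heisenberg group multiplication. -/
noncomputable def Hmul (p q : Hei) : Hei :=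
  (p.1 + q.1, p.2.1 + q.2.1, p.2.2 + q.2.2 + (p.1 * q.2.1 - q.1 * p.2.1) / 2)

/-- Heisenberg group inverse. -/
def Hinv (p : Hei) : Hei := (-p.1, -p.2.1, -p.2.2)

/-- Homogeneous norm on the Heisenberg group. -/
noncomputable def Hnorm (p : Hei) : ℝ :=
  max (Real.sqrt (p.1 ^ 2 + p.2.1 ^ 2)) (Real.sqrt |p.2.2|)

/-- Left-invariant metric `d(p,q) = ‖q⁻¹·p‖` on the Heisenberg group. -/
noncomputable def dH (p q : Hei) : ℝ := Hnorm (Hmul (Hinv q) p)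

/-- Parabolic metric on the parabolic plane 𝕎 = ℝ². -/
noncomputable def dPar (w w' : ℝ × ℝ) : ℝ :=
  max |w.1 - w'.1| (Real.sqrt |w.2 - w'.2|)

/-- Distance from a point to a set in (ℍ, d). -/
noncomputable def distH (p : Hei) (E : Set Hei) : ℝ := sInf ((dH p) '' E)

/-- Closed δ-neighbourhood of a set in ℍ. -/
def NH (E : Set Hei) (δ : ℝ) : Set Hei := {p | distH p E ≤ δ}

/-- Closed ball in (ℍ, d). -/
def BH (p : Hei) (r : ℝ) : Set Hei := {q | dH q p ≤ r}

/-- Closed parabolic ball in 𝕎. -/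
def BPar (w : ℝ × ℝ) (r : ℝ) : Set (ℝ × ℝ) := {v | dPar v w ≤ r}

/-- Diameter (in ℝ≥0∞) with respect to the Heisenberg metric. -/
noncomputable def ediamH (E : Set Hei) : ℝ≥0∞ :=
  ⨆ p ∈ E, ⨆ q ∈ E, ENNReal.ofReal (dH p q)

/-- The 3-dimensional Hausdorff measure on (ℍ, d), as a set function. -/
noncomputable def H3 (E : Set Hei) : ℝ≥0∞ :=
  ⨆ (δ : ℝ≥0∞) (_ : 0 < δ),
    ⨅ (U : ℕ → Set Hei) (_ : E ⊆ ⋃ n, U n) (_ : ∀ n, ediamH (U n) ≤ δ),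
      ∑' n, ediamH (U n) ^ 3

/-- Isometric embedding of the parabolic plane onto the subgroup 𝕎 ⊂ ℍ. -/
def embedW (w : ℝ × ℝ) : Hei := (0, w.1, w.2)

/-- The vertical subgroup 𝕎 = {(0,y,t)} of ℍ. -/
def Wsub : Set Hei := {p | p.1 = 0}

/-- Rotation by angle θ about the t-axis. -/
noncomputable def Rrot (θ : ℝ) (p : Hei) : Hei :=
  (p.1 * Real.cos θ - p.2.1 * Real.sin θ, p.1 * Real.sin θ + p.2.1 * Real.cos θ, p.2.2)

/-- Vertical projection Π : ℍ → 𝕎. -/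
noncomputable def Piproj (p : Hei) : Hei := (0, p.2.1, p.2.2 + p.1 * p.2.1 / 2)

/-- Horizontal projection Π_𝕃 : ℍ → 𝕃. -/
def PiL (p : Hei) : Hei := (p.1, 0, 0)

/-- Vertical projection Π_θ = R_θ ∘ Π ∘ R_θ⁻¹ onto 𝕎_θ. -/
noncomputable def PiTheta (θ : ℝ) (p : Hei) : Hei := Rrot θ (Piproj (Rrot (-θ) p))

/-- `f : 𝕎 → ℍ` is M-bilipschitz. -/
def IsBilipschitz (M : ℝ) (f : ℝ × ℝ → Hei) : Prop :=
  ∀ w w' : ℝ × ℝ,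
    M⁻¹ * dPar w w' ≤ dH (f w) (f w') ∧ dH (f w) (f w') ≤ M * dPar w w'

/-- A Rickman rug: the image of the parabolic plane under a bilipschitz map. -/
def IsRickmanRug (E : Set Hei) : Prop :=
  ∃ M : ℝ, 1 ≤ M ∧ ∃ f : ℝ × ℝ → Hei, IsBilipschitz M f ∧ E = Set.range f

/-- A horizontal line in ℍ. -/
def IsHorizontalLine (L : Set Hei) : Prop :=
  ∃ p : Hei, ∃ v : ℝ × ℝ, v ≠ 0 ∧
    L = {q | ∃ s : ℝ, q = Hmul p (s * v.1, s * v.2, 0)}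

/-- The vertical plane spanned by a horizontal line. -/
def VSpan (L : Set Hei) : Set Hei := {q | ∃ p ∈ L, ∃ t : ℝ, q = Hmul p (0, 0, t)}

/-- Vertical planes in ℍ. -/
def IsVerticalPlane (V : Set Hei) : Prop :=
  ∃ L : Set Hei, IsHorizontalLine L ∧ V = VSpan L

/-- The horizontal line {(a·y + b, y, b·y/2 + c) : y ∈ ℝ} (of slope |a|). -/
def hline (a b c : ℝ) : Set Hei :=
  {p | ∃ y : ℝ, p = (a * y + b, y, b * y / 2 + c)}

/-- A horizontal line of (finite) slope at most Σ. -/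
def HLineSlopeLe (S : ℝ) (L : Set Hei) : Prop :=
  ∃ a b c : ℝ, |a| ≤ S ∧ L = hline a b c

/-- A vertical plane of (finite) slope at most Σ (relative to 𝕎). -/
def VPlaneSlopeLe (S : ℝ) (V : Set Hei) : Prop :=
  ∃ a b : ℝ, |a| ≤ S ∧ V = {p : Hei | p.1 = a * p.2.1 + b}

/-- A vertical plane whose slope relative to 𝕎_θ equals 0. -/
def SlopeZeroRel (θ : ℝ) (V : Set Hei) : Prop :=
  ∃ b : ℝ, Rrot (-θ) '' V = {p : Hei | p.1 = b}

/-- The horizontal line ℝ × {t} in the parabolic plane. -/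
def lineW (t : ℝ) : Set (ℝ × ℝ) := {w | w.2 = t}

/-- Ruler coefficient ρ_f(B_par(w,r)). -/
noncomputable def rulerCoef (f : ℝ × ℝ → Hei) (w : ℝ × ℝ) (r : ℝ) : ℝ :=
  sInf {ρ : ℝ | 0 < ρ ∧ ∀ t : ℝ, ∃ L : Set Hei, IsHorizontalLine L ∧
    f '' (lineW t ∩ BPar w r) ⊆ NH L (ρ * r)}

/-- β_f(𝕍; B_par(w,r)): approximation number relative to the vertical plane 𝕍. -/
noncomputable def betaV (f : ℝ × ℝ → Hei) (V : Set Hei) (w : ℝ × ℝ) (r : ℝ) : ℝ :=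
  sInf {ε : ℝ | 0 < ε ∧ ∀ t : ℝ, ∃ L : Set Hei, IsHorizontalLine L ∧ L ⊆ V ∧
    f '' (lineW t ∩ BPar w r) ⊆ NH L (ε * r)}

/-- The strong vertical β-number β_f(B_par(w,r)) = inf_𝕍 β_f(𝕍; B_par(w,r)). -/
noncomputable def beta (f : ℝ × ℝ → Hei) (w : ℝ × ℝ) (r : ℝ) : ℝ :=
  sInf {b : ℝ | ∃ V : Set Hei, IsVerticalPlane V ∧ b = betaV f V w r}

/-- Index set for dyadic parabolic rectangles: (n, k, l). -/
abbrev Idx : Type := ℤ × ℤ × ℤ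

/-- Side length ℓ(Q) = 2⁻ⁿ of the dyadic parabolic rectangle with index (n,k,l). -/
noncomputable def sideLen (i : Idx) : ℝ := (2 : ℝ) ^ (-i.1)

/-- The dyadic parabolic rectangle [k·2⁻ⁿ, (k+1)·2⁻ⁿ) × [l·4⁻ⁿ, (l+1)·4⁻ⁿ). -/
noncomputable def rect (i : Idx) : Set (ℝ × ℝ) :=
  Set.Ico ((i.2.1 : ℝ) * (2 : ℝ) ^ (-i.1)) (((i.2.1 : ℝ) + 1) * (2 : ℝ) ^ (-i.1)) ×ˢ
  Set.Ico ((i.2.2 : ℝ) * (4 : ℝ) ^ (-i.1)) (((i.2.2 : ℝ) + 1) * (4 : ℝ) ^ (-i.1))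

/-- The centre c_Q of a dyadic parabolic rectangle. -/
noncomputable def center (i : Idx) : ℝ × ℝ :=
  (((i.2.1 : ℝ) + 1 / 2) * (2 : ℝ) ^ (-i.1), ((i.2.2 : ℝ) + 1 / 2) * (4 : ℝ) ^ (-i.1))

/-- λQ := B_par(c_Q, λ·ℓ(Q)). -/
noncomputable def dilate (lam : ℝ) (i : Idx) : Set (ℝ × ℝ) := BPar (center i) (lam * sideLen i)

/-- j indexes a 𝒟-child of the rectangle indexed by i. -/
def IsChild (j i : Idx) : Prop := j.1 = i.1 + 1 ∧ rect j ⊆ rect i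

/-- T ⊆ 𝒟 is a tree with root rt. -/
def IsTreeWithRoot (T : Set Idx) (rt : Idx) : Prop :=
  rt ∈ T ∧ (∀ i ∈ T, rect i ⊆ rect rt) ∧
  (∀ i j k : Idx, i ∈ T → k ∈ T → rect i ⊆ rect j → rect j ⊆ rect k → j ∈ T) ∧
  (∀ i ∈ T, (∀ j : Idx, IsChild j i → j ∈ T) ∨ (∀ j : Idx, IsChild j i → j ∉ T))

/-- T ⊆ 𝒟 is a tree. -/
def IsTree (T : Set Idx) : Prop := ∃ rt : Idx, IsTreeWithRoot T rt

/-- Q is (ε,H,Σ)-vertical for f : there is a vertical plane 𝕍_Q of slope ≤ Σ with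
β_f(𝕍_Q; HQ) < ε/H. -/
def IsVerticalRect (f : ℝ × ℝ → Hei) (ε Hc S : ℝ) (i : Idx) : Prop :=
  ∃ V : Set Hei, VPlaneSlopeLe S V ∧ betaV f V (center i) (Hc * sideLen i) < ε / Hc

/-- Q is (δ,C)-ruled for f. -/
def IsRuled (f : ℝ × ℝ → Hei) (δ C : ℝ) (i : Idx) : Prop :=
  ∀ t : ℝ, ∃ L : Set Hei, IsHorizontalLine L ∧
    f '' (lineW t ∩ dilate C i) ⊆ NH L (δ * sideLen i)

/-- Q is (δ,C,Σ)-ruled for f. -/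
def IsRuledSlope (f : ℝ × ℝ → Hei) (δ C S : ℝ) (i : Idx) : Prop :=
  IsRuled f δ C i ∧ ∃ t : ℝ, (lineW t ∩ rect i).Nonempty ∧
    ∃ L : Set Hei, HLineSlopeLe S L ∧
      f '' (lineW t ∩ dilate C i) ⊆ NH L (δ * sideLen i)

/-- Γ is an intrinsic L-Lipschitz graph over 𝕎. -/
def IsIntrinsicLipGraph (L : ℝ) (Γ : Set Hei) : Prop :=
  Set.BijOn Piproj Γ Wsub ∧
  ∀ p ∈ Γ, ∀ q ∈ Γ,
    Hnorm (PiL (Hmul (Hinv q) p)) ≤ L * Hnorm (Piproj (Hmul (Hinv q) p))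

/-- Γ is an intrinsic L-Lipschitz graph over 𝕎_θ. -/
def IsIntrinsicLipGraphOver (θ L : ℝ) (Γ : Set Hei) : Prop :=
  IsIntrinsicLipGraph L (Rrot (-θ) '' Γ)

/-- An intrinsic bilipschitz graph: an intrinsic Lipschitz graph over some vertical
subgroup which is also a Rickman rug. -/
def IsIntrinsicBilipGraph (Γ : Set Hei) : Prop :=
  (∃ θ ∈ Set.Ico (-(Real.pi / 2)) (Real.pi / 2), ∃ L : ℝ, 1 ≤ L ∧
    IsIntrinsicLipGraphOver θ L Γ) ∧ IsRickmanRug Γ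

/-- (M,ε)-quasi-isometric embedding between sets with distance functions. -/
def IsQIEOn {X Y : Type*} (dX : X → X → ℝ) (dY : Y → Y → ℝ) (A : Set X)
    (M ε : ℝ) (F : X → Y) : Prop :=
  ∀ x ∈ A, ∀ x' ∈ A,
    M⁻¹ * dX x x' - ε ≤ dY (F x) (F x') ∧ dY (F x) (F x') ≤ M * dX x x' + ε

/-- d is a metric on ℝ. -/
def IsMetricOn (d : ℝ → ℝ → ℝ) : Prop :=
  (∀ x y, d x y = d y x) ∧ (∀ x y, d x y = 0 ↔ x = y) ∧
  (∀ x y z, d x z ≤ d x y + d y z)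

/-- d is an orderly metric on ℝ. -/
def Orderly (d : ℝ → ℝ → ℝ) : Prop :=
  IsMetricOn d ∧
  (∀ x : ℝ, ∀ ε > (0 : ℝ), ∃ δ > (0 : ℝ), ∀ y : ℝ, |x - y| < δ → d x y < ε) ∧
  (∀ x y z : ℝ, x ≤ y → y ≤ z → max (d x y) (d y z) ≤ d x z)

/-- F : I×J → 𝕎 is a horizontal (M,ε)-QIE. -/
def IsHorizQIE (M ε : ℝ) (I J : Set ℝ) (F : ℝ × ℝ → ℝ × ℝ) : Prop :=
  IsQIEOn dPar dPar (I ×ˢ J) M ε F ∧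
  (∀ t ∈ J, ∃ c : ℝ, ∀ y ∈ I, (F (y, t)).2 = c)



lemma Hnorm_le_iff {p : Hei} {r : ℝ} (hr : 0 ≤ r) :
    Hnorm p ≤ r ↔ p.1 ^ 2 + p.2.1 ^ 2 ≤ r ^ 2 ∧ |p.2.2| ≤ r ^ 2 := by
  unfold Hnorm
  rw [max_le_iff, Real.sqrt_le_left hr, Real.sqrt_le_left hr]

lemma Hnorm_nonneg (p : Hei) : 0 ≤ Hnorm p := le_max_of_le_left (Real.sqrt_nonneg _)

lemma Hnorm_sq (p : Hei) : p.1 ^ 2 + p.2.1 ^ 2 ≤ Hnorm p ^ 2 ∧ |p.2.2| ≤ Hnorm p ^ 2 :=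
  (Hnorm_le_iff (Hnorm_nonneg p)).1 le_rfl

lemma dH_nonneg (p q : Hei) : 0 ≤ dH p q := Hnorm_nonneg _

lemma Hnorm_mul (p q : Hei) : Hnorm (Hmul p q) ≤ Hnorm p + Hnorm q := by
  have hp := Hnorm_nonneg p
  have hq := Hnorm_nonneg q
  obtain ⟨h1, h2⟩ := Hnorm_sq p
  obtain ⟨h3, h4⟩ := Hnorm_sq q
  rw [Hnorm_le_iff (by positivity)]
  generalize Hnorm p = a at *
  generalize Hnorm q = b at *
  have hcs : (p.1 * q.1 + p.2.1 * q.2.1) ^ 2 + (p.1 * q.2.1 - q.1 * p.2.1) ^ 2 ≤ (a * b) ^ 2 := by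
    have : (p.1 * q.1 + p.2.1 * q.2.1) ^ 2 + (p.1 * q.2.1 - q.1 * p.2.1) ^ 2
      = (p.1 ^ 2 + p.2.1 ^ 2) * (q.1 ^ 2 + q.2.1 ^ 2) := by ring
    rw [this, mul_pow]
    gcongr
  have hab : 0 ≤ a * b := by positivity
  have hA : p.1 * q.1 + p.2.1 * q.2.1 ≤ a * b := by
    apply abs_le_of_sq_le_sq' _ hab |>.2
    nlinarith [sq_nonneg (p.1 * q.2.1 - q.1 * p.2.1)]
  have hB := abs_le_of_sq_le_sq' (a := p.1 * q.2.1 - q.1 * p.2.1) (b := a * b)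
    (by nlinarith [sq_nonneg (p.1 * q.1 + p.2.1 * q.2.1)]) hab
  simp only [Hmul]
  constructor
  · nlinarith
  · rw [abs_le] at *
    constructor <;> nlinarith

lemma Hmul_assoc (p q r : Hei) : Hmul (Hmul p q) r = Hmul p (Hmul q r) := by
  simp only [Hmul, Prod.mk.injEq]
  refine ⟨by ring, by ring, by ring⟩

lemma Hinv_mul_cancel (q p : Hei) : Hmul (Hinv q) (Hmul q p) = p := by
  obtain ⟨a, b, c⟩ := p
  simp only [Hmul, Hinv, Prod.mk.injEq]
  refine ⟨by ring, by ring, by ring⟩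

lemma Hmul_inv_cancel (q p : Hei) : Hmul q (Hmul (Hinv q) p) = p := by
  obtain ⟨a, b, c⟩ := p
  simp only [Hmul, Hinv, Prod.mk.injEq]
  refine ⟨by ring, by ring, by ring⟩

lemma dH_triangle (p q r : Hei) : dH p r ≤ dH p q + dH q r := by
  have : Hmul (Hinv r) p = Hmul (Hmul (Hinv r) q) (Hmul (Hinv q) p) := by
    rw [Hmul_assoc, Hmul_inv_cancel]
  unfold dH
  rw [this]
  linarith [Hnorm_mul (Hmul (Hinv r) q) (Hmul (Hinv q) p)]

lemma dH_comm (p q : Hei) : dH p q = dH q p := by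
  simp only [dH, Hnorm, Hmul, Hinv]
  congr 2
  · ring
  · rw [← abs_neg]; congr 1; ring

lemma dH_left (g p q : Hei) : dH (Hmul g p) (Hmul g q) = dH p q := by
  have : Hmul (Hinv (Hmul g q)) (Hmul g p) = Hmul (Hinv q) p := by
    simp only [Hmul, Hinv, Prod.mk.injEq]
    refine ⟨by ring, by ring, by ring⟩
  unfold dH; rw [this]

/-- dilations -/
def Hdil (s : ℝ) (p : Hei) : Hei := (s * p.1, s * p.2.1, s ^ 2 * p.2.2)

lemma Hdil_mul (s : ℝ) (p q : Hei) : Hdil s (Hmul p q) = Hmul (Hdil s p) (Hdil s q) := by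
  simp only [Hmul, Hdil, Prod.mk.injEq]
  refine ⟨by ring, by ring, by ring⟩

lemma Hnorm_dil {s : ℝ} (hs : 0 ≤ s) (p : Hei) : Hnorm (Hdil s p) = s * Hnorm p := by
  simp only [Hnorm, Hdil]
  rw [show (s * p.1) ^ 2 + (s * p.2.1) ^ 2 = s ^ 2 * (p.1 ^ 2 + p.2.1 ^ 2) by ring,
    abs_mul, abs_of_nonneg (sq_nonneg s), Real.sqrt_mul (sq_nonneg s), Real.sqrt_mul (sq_nonneg s),
    Real.sqrt_sq hs, mul_max_of_nonneg _ _ hs]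

lemma dH_dil {s : ℝ} (hs : 0 ≤ s) (p q : Hei) : dH (Hdil s p) (Hdil s q) = s * dH p q := by
  unfold dH
  rw [← Hnorm_dil hs, Hdil_mul]
  congr 2
  simp only [Hinv, Hdil, Prod.mk.injEq]
  refine ⟨by ring, by ring, by ring⟩

lemma Hdil_dil {s : ℝ} (hs : s ≠ 0) (p : Hei) : Hdil s (Hdil s⁻¹ p) = p := by
  obtain ⟨a, b, c⟩ := p
  simp only [Hdil, Prod.mk.injEq]
  refine ⟨by field_simp, by field_simp, by field_simp⟩

lemma abs_le_of_sq_add {x y r : ℝ} (hr : 0 ≤ r) (h : x ^ 2 + y ^ 2 ≤ r ^ 2) : |x| ≤ r ∧ |y| ≤ r :=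
  ⟨abs_le_of_sq_le_sq (by nlinarith [sq_nonneg y]) hr,
    abs_le_of_sq_le_sq (by nlinarith [sq_nonneg x]) hr⟩

lemma abs_mul_le {x y a b : ℝ} (hx : |x| ≤ a) (hy : |y| ≤ b) : |x * y| ≤ a * b := by
  rw [abs_mul]
  exact mul_le_mul hx hy (abs_nonneg _) ((abs_nonneg _).trans hx)

/-- Sequence lemma. -/
lemma seq_lemma (p : ℕ → Hei) (n : ℕ) (M h θ a b : ℝ) (hM : 0 ≤ M) (hh : 0 ≤ h) (hθ : 0 ≤ θ)
    (ha : |a| ≤ M * h) (hb : |b| ≤ M * h)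
    (hd : ∀ k < n, dH (p (k + 1)) (p k) ≤ M * h)
    (hx : ∀ k < n, |(p (k + 1)).1 - (p k).1 - a| ≤ θ)
    (hy : ∀ k < n, |(p (k + 1)).2.1 - (p k).2.1 - b| ≤ θ) (r : ℝ) (hr : 0 ≤ r)
    (hr1 : 2 * n * θ ≤ r)
    (hr2 : n * (M * h) ^ 2 + n ^ 2 * (3 * M * h * θ + θ ^ 2) ≤ r ^ 2) :
    ∀ k ≤ n, dH (p k) (Hmul (p 0) (k * a, k * b, 0)) ≤ r := by
  have key : ∀ k ≤ n, |(p k).1 - (p 0).1 - k * a| ≤ k * θ ∧ |(p k).2.1 - (p 0).2.1 - k * b| ≤ k * θ ∧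
      |(p k).2.2 - (p 0).2.2 - ((p 0).1 * (p k).2.1 - (p 0).2.1 * (p k).1) / 2| ≤
        k * ((M * h) ^ 2 + n * (2 * M * h * θ + θ ^ 2)) := by
    intro k
    induction k with
    | zero => intro _; simp; ring_nf
    | succ k ih =>
      intro hk
      obtain ⟨h1, h2, h3⟩ := ih (by omega)
      have hkn : (k : ℝ) ≤ n := by exact_mod_cast (by omega : k ≤ n)
      have hx' := hx k (by omega)
      have hy' := hy k (by omega)
      have hz := ((Hnorm_le_iff (by positivity)).1 (hd k (by omega))).2
      simp only [Hmul, Hinv] at hz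
      push_cast
      generalize p (k + 1) = P at *
      generalize p k = Q at *
      generalize p 0 = O at *
      have e1 : |P.1 - O.1 - (k + 1) * a| ≤ (k + 1) * θ := by
        rw [abs_le] at *; constructor <;> linarith
      have e2 : |P.2.1 - O.2.1 - (k + 1) * b| ≤ (k + 1) * θ := by
        rw [abs_le] at *; constructor <;> linarith
      refine ⟨e1, e2, ?_⟩
      have f1 := abs_mul_le h1 hb
      have f2 := abs_mul_le h2 ha
      have g1 := abs_mul_le h1 hy'
      have g2 := abs_mul_le h2 hx'
      have ka : |k * a| ≤ k * (M * h) := abs_mul_le (by simp) ha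
      have kb : |k * b| ≤ k * (M * h) := abs_mul_le (by simp) hb
      have i1 := abs_mul_le ka hy'
      have i2 := abs_mul_le kb hx'
      have : P.2.2 - O.2.2 - (O.1 * P.2.1 - O.2.1 * P.1) / 2 =
        (Q.2.2 - O.2.2 - (O.1 * Q.2.1 - O.2.1 * Q.1) / 2) +
        (-Q.2.2 + P.2.2 + (-Q.1 * P.2.1 - P.1 * -Q.2.1) / 2) +
        ((Q.1 - O.1 - k * a) * b + k * a * (P.2.1 - Q.2.1 - b)
          + (Q.1 - O.1 - k * a) * (P.2.1 - Q.2.1 - b)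
          - (Q.2.1 - O.2.1 - k * b) * a - k * b * (P.1 - Q.1 - a)
          - (Q.2.1 - O.2.1 - k * b) * (P.1 - Q.1 - a)) / 2 := by ring
      rw [this]
      have hk2 : (k : ℝ) * (2 * M * h * θ + θ ^ 2) ≤ n * (2 * M * h * θ + θ ^ 2) := by gcongr
      rw [abs_le] at *
      constructor <;> linarith
  intro k hk
  obtain ⟨h1, h2, h3⟩ := key k hk
  have hkn : (k : ℝ) ≤ n := by exact_mod_cast hk
  unfold dH
  rw [Hnorm_le_iff hr]
  simp only [Hmul, Hinv]
  generalize p k = P at *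
  generalize p 0 = O at *
  have hkt : (k : ℝ) * θ ≤ n * θ := by gcongr
  constructor
  · have s1 : (P.1 - O.1 - k * a) ^ 2 ≤ (n * θ) ^ 2 := sq_le_sq' (by rw [abs_le] at h1; linarith) (by rw [abs_le] at h1; linarith)
    have s2 : (P.2.1 - O.2.1 - k * b) ^ 2 ≤ (n * θ) ^ 2 := sq_le_sq' (by rw [abs_le] at h2; linarith) (by rw [abs_le] at h2; linarith)
    have s3 : (2 * n * θ) ^ 2 ≤ r ^ 2 := by gcongr
    nlinarith [sq_nonneg (n * θ)]
  · have ka : |k * a| ≤ n * (M * h) := abs_mul_le (by simpa) ha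
    have kb : |k * b| ≤ n * (M * h) := abs_mul_le (by simpa) hb
    have i1 := abs_mul_le ka (h2.trans hkt)
    have i2 := abs_mul_le kb (h1.trans hkt)
    have : -(O.2.2 + 0 + (O.1 * (k * b) - k * a * O.2.1) / 2) + P.2.2 +
        (-(O.1 + k * a) * P.2.1 - P.1 * -(O.2.1 + k * b)) / 2
      = (P.2.2 - O.2.2 - (O.1 * P.2.1 - O.2.1 * P.1) / 2)
        + (k * b * (P.1 - O.1 - k * a) - k * a * (P.2.1 - O.2.1 - k * b)) / 2 := by ring
    rw [this]
    have hk2 : (k : ℝ) * ((M * h) ^ 2 + n * (2 * M * h * θ + θ ^ 2)) ≤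
      n * ((M * h) ^ 2 + n * (2 * M * h * θ + θ ^ 2)) := by gcongr
    rw [abs_le] at *
    constructor <;> nlinarith

lemma line_step (p : Hei) (σ τ u v M h : ℝ) (hM : 0 ≤ M) (hh : 0 ≤ h) (hu : |u| ≤ M) (hv : |v| ≤ M)
    (hs : |σ - τ| ≤ h) :
    dH (Hmul p (σ * u, σ * v, 0)) (Hmul p (τ * u, τ * v, 0)) ≤ 2 * M * h := by
  rw [dH_left]
  unfold dH
  rw [Hnorm_le_iff (by positivity)]
  simp only [Hmul, Hinv]
  have x1 : |(σ - τ) * u| ≤ h * M := abs_mul_le hs hu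
  have x2 : |(σ - τ) * v| ≤ h * M := abs_mul_le hs hv
  constructor
  · rw [show -(τ * u) + σ * u = (σ - τ) * u by ring, show -(τ * v) + σ * v = (σ - τ) * v by ring]
    have := sq_le_sq' (abs_le.1 x1).1 (abs_le.1 x1).2
    have := sq_le_sq' (abs_le.1 x2).1 (abs_le.1 x2).2
    nlinarith [sq_nonneg (h * M)]
  · have : -0 + 0 + (-(τ * u) * (σ * v) - σ * u * -(τ * v)) / 2 = 0 := by ring
    rw [this, abs_zero]; positivity

set_option maxHeartbeats 1000000 in
lemma curve_lemma (M T δ : ℝ) (hM : 1 ≤ M) (hT : 1 ≤ T) (hδ : 0 < δ) :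
    ∃ h > 0, ∃ η > 0, ∀ γ : ℝ → Hei, (∀ x y, dH (γ x) (γ y) ≤ M * |x - y|) →
      (∀ x, 0 ≤ x → x ≤ T → |(γ (x + 2 * h)).1 - 2 * (γ (x + h)).1 + (γ x).1| ≤ η ∧
        |(γ (x + 2 * h)).2.1 - 2 * (γ (x + h)).2.1 + (γ x).2.1| ≤ η) →
      ∃ u v : ℝ, |u| ≤ M ∧ |v| ≤ M ∧ ∀ τ, 0 ≤ τ → τ ≤ T →
        dH (γ τ) (Hmul (γ 0) (τ * u, τ * v, 0)) ≤ δ := by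
  set h₀ : ℝ := min 1 (min (δ / (6 * M)) (δ ^ 2 / (4 * (T * M ^ 2 + 3 * M + 1)))) with hh₀
  have h₀pos : 0 < h₀ := by
    refine lt_min one_pos (lt_min ?_ ?_) <;> positivity
  obtain ⟨n, hn⟩ := exists_nat_gt (T / h₀)
  have hn0 : (0 : ℝ) < n := lt_of_le_of_lt (by positivity) hn
  have hn1 : (1 : ℝ) ≤ n := by exact_mod_cast hn0
  set h : ℝ := T / n with hh
  have hhpos : 0 < h := by positivity
  have hhlt : h ≤ h₀ := by
    rw [hh, div_le_iff₀ hn0]; rw [div_lt_iff₀ h₀pos] at hn; linarith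
  have b1 : h ≤ 1 := hhlt.trans (min_le_left _ _)
  have b2 : h * (6 * M) ≤ δ := by
    rw [← le_div_iff₀ (by positivity)]
    exact hhlt.trans ((min_le_right _ _).trans (min_le_left _ _))
  have b3 : h * (4 * (T * M ^ 2 + 3 * M + 1)) ≤ δ ^ 2 := by
    rw [← le_div_iff₀ (by positivity)]
    exact hhlt.trans ((min_le_right _ _).trans (min_le_right _ _))
  have hnh : n * h = T := by rw [hh]; field_simp
  refine ⟨h, hhpos, h ^ 2 / n ^ 3, by positivity, ?_⟩
  intro γ hγ hΔ
  set θ : ℝ := h ^ 2 / n ^ 2 with hθ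
  have hθpos : 0 ≤ θ := by positivity
  set a := (γ h).1 - (γ 0).1 with ha
  set b := (γ h).2.1 - (γ 0).2.1 with hb
  have hab : |a| ≤ M * h ∧ |b| ≤ M * h := by
    have h1 := hγ h 0
    rw [sub_zero, abs_of_pos hhpos] at h1
    have h2 := ((Hnorm_le_iff (by positivity)).1 h1).1
    simp only [Hmul, Hinv] at h2
    have := abs_le_of_sq_add (by positivity) h2
    rw [neg_add_eq_sub, neg_add_eq_sub] at this
    exact this
  have hkT : ∀ k : ℕ, k ≤ n → (k : ℝ) * h ≤ T := by
    intro k hk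
    have : (k : ℝ) ≤ n := by exact_mod_cast hk
    rw [← hnh]; gcongr
  have inc : ∀ k : ℕ, k ≤ n →
      |(γ ((k + 1 : ℕ) * h)).1 - (γ (k * h)).1 - a| ≤ k * (h ^ 2 / n ^ 3) ∧
      |(γ ((k + 1 : ℕ) * h)).2.1 - (γ (k * h)).2.1 - b| ≤ k * (h ^ 2 / n ^ 3) := by
    intro k
    induction k with
    | zero => intro _; simp [ha, hb]
    | succ k ih =>
      intro hk
      obtain ⟨i1, i2⟩ := ih (by omega)
      obtain ⟨j1, j2⟩ := hΔ (k * h) (by positivity) (hkT k (by omega))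
      rw [show (k : ℝ) * h + 2 * h = ((k + 1 + 1 : ℕ) : ℝ) * h by push_cast; ring,
        show (k : ℝ) * h + h = ((k + 1 : ℕ) : ℝ) * h by push_cast; ring] at j1 j2
      generalize γ ((k + 1 + 1 : ℕ) * h) = P at *
      generalize γ ((k + 1 : ℕ) * h) = Q at *
      generalize γ (k * h) = R at *
      push_cast
      rw [abs_le] at *
      rw [abs_le] at *
      constructor <;> constructor <;> linarith
  have hθn : (n : ℝ) * (h ^ 2 / n ^ 3) = θ := by rw [hθ]; field_simp
  have kθ : ∀ k : ℕ, k < n → (k : ℝ) * (h ^ 2 / n ^ 3) ≤ θ := by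
    intro k hk
    have : (k : ℝ) ≤ n := by exact_mod_cast hk.le
    rw [← hθn]; gcongr
  have hθ2 : n ^ 2 * θ = h ^ 2 := by rw [hθ]; field_simp
  have hnθ : n * θ ≤ h := by
    have : n * θ ≤ n ^ 2 * θ := by gcongr; nlinarith
    nlinarith
  have hθh : θ ≤ h := by nlinarith
  have hseq := seq_lemma (fun k => γ (k * h)) n M h θ a b (by linarith) hhpos.le hθpos hab.1 hab.2
    (by
      intro k hk
      have := hγ ((k + 1 : ℕ) * h) (k * h)
      rw [show ((k + 1 : ℕ) : ℝ) * h - k * h = h by push_cast; ring, abs_of_pos hhpos] at this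
      exact this)
    (fun k hk => (inc k hk.le).1.trans (kθ k hk)) (fun k hk => (inc k hk.le).2.trans (kθ k hk))
    (δ / 2) (by positivity) (by nlinarith) (by
      have e1 : (n : ℝ) * (M * h) ^ 2 = T * M ^ 2 * h := by rw [← hnh]; ring
      have e2 : (n : ℝ) ^ 2 * (3 * M * h * θ + θ ^ 2) = h ^ 2 * (3 * M * h + θ) := by
        rw [← hθ2]; ring
      rw [e1, e2]
      have e3 : h ^ 2 ≤ 1 := by nlinarith
      have e4 : 0 ≤ 3 * M * h + θ := by positivity
      nlinarith)
  refine ⟨a / h, b / h, ?_, ?_, ?_⟩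
  · rw [abs_div, abs_of_pos hhpos, div_le_iff₀ hhpos]; exact hab.1
  · rw [abs_div, abs_of_pos hhpos, div_le_iff₀ hhpos]; exact hab.2
  intro τ hτ0 hτT
  set k := ⌊τ / h⌋₊ with hk
  have k1 : (k : ℝ) * h ≤ τ := by
    rw [← le_div_iff₀ hhpos]; exact Nat.floor_le (by positivity)
  have k2 : τ ≤ k * h + h := by
    have := (Nat.lt_floor_add_one (τ / h)).le
    rw [div_le_iff₀ hhpos] at this; linarith
  have kn : k ≤ n := by
    have : (k : ℝ) * h ≤ n * h := by rw [hnh]; linarith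
    exact_mod_cast le_of_mul_le_mul_right this hhpos
  have d1 : dH (γ τ) (γ (k * h)) ≤ M * h := by
    refine (hγ _ _).trans ?_
    gcongr
    rw [abs_le]; constructor <;> linarith
  have d2 := hseq k kn
  simp only [Nat.cast_zero, zero_mul] at d2
  have ha' : |a / h| ≤ M := by rw [abs_div, abs_of_pos hhpos, div_le_iff₀ hhpos]; exact hab.1
  have hb' : |b / h| ≤ M := by rw [abs_div, abs_of_pos hhpos, div_le_iff₀ hhpos]; exact hab.2
  have d3 := line_step (γ 0) (k * h) τ (a / h) (b / h) M h (by linarith) hhpos.le ha' hb'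
    (by rw [abs_le]; constructor <;> linarith)
  rw [show k * h * (a / h) = k * a by field_simp, show k * h * (b / h) = k * b by field_simp] at d3
  have t1 := dH_triangle (γ τ) (γ (k * h)) (Hmul (γ 0) (τ * (a / h), τ * (b / h), 0))
  have t2 := dH_triangle (γ (k * h)) (Hmul (γ 0) (k * a, k * b, 0)) (Hmul (γ 0) (τ * (a / h), τ * (b / h), 0))
  nlinarith

set_option maxHeartbeats 1000000 in
lemma two_lines (M C D T s : ℝ) (hM : 1 ≤ M) (hC : 1 ≤ C) (hD : 0 < D) (hT : 1 ≤ T) (hs : 0 < s)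
    (hs1 : 2 * (80 * M * D ^ 2 + 8 * C * D) ≤ s * T)
    (hs2 : 320 * C * M ^ 2 * D ^ 2 + 16 * C ^ 2 * M * D ≤ s ^ 2 * T)
    (p p₀ : Hei) (u v u₀ v₀ : ℝ) (hu : |u| ≤ M) (hv : |v| ≤ M) (hu₀ : |u₀| ≤ M) (hv₀ : |v₀| ≤ M)
    (hq : 1 ≤ (u₀ ^ 2 + v₀ ^ 2) * (2 * M) ^ 2)
    (hd : ∀ τ, 0 ≤ τ → τ ≤ T →
      dH (Hmul p (τ * u, τ * v, 0)) (Hmul p₀ (τ * u₀, τ * v₀, 0)) ≤ 2 * D) :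
    ∃ l c : ℝ, ∀ τ, 0 ≤ τ → τ ≤ 2 * C →
      dH (Hmul p (τ * u, τ * v, 0))
        (Hmul (Hmul p₀ (l * u₀, l * v₀, c)) (τ * u₀, τ * v₀, 0)) ≤ s := by
  obtain ⟨⟨a₁, a₂, c₀⟩, hg⟩ : ∃ g, g = Hmul (Hinv p₀) p := ⟨_, rfl⟩
  have hp : p = Hmul p₀ (a₁, a₂, c₀) := by rw [hg, Hmul_inv_cancel]
  subst hp
  simp only [Hmul_assoc, dH_left] at hd ⊢
  clear hg
  have hd' : ∀ τ, 0 ≤ τ → τ ≤ T → |a₁ + τ * (u - u₀)| ≤ 2 * D ∧ |a₂ + τ * (v - v₀)| ≤ 2 * D ∧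
      |c₀ + τ * (a₁ * (v + v₀) - a₂ * (u + u₀)) / 2 - τ ^ 2 * (u₀ * v - v₀ * u) / 2| ≤ (2 * D) ^ 2 := by
    intro τ h1 h2
    have := (Hnorm_le_iff (by positivity)).1 (hd τ h1 h2)
    simp only [Hmul, Hinv] at this
    have h3 := abs_le_of_sq_add (by positivity) this.1
    refine ⟨?_, ?_, ?_⟩
    · convert h3.1 using 2; ring
    · convert h3.2 using 2; ring
    · convert this.2 using 2; ring
  clear hd
  obtain ⟨x0, y0, z0⟩ := hd' 0 le_rfl (by linarith)
  obtain ⟨x1, y1, z1⟩ := hd' (T / 2) (by linarith) (by linarith)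
  obtain ⟨x2, y2, z2⟩ := hd' T (by linarith) (by linarith)
  clear hd'
  have hTpos : 0 < T := by linarith
  have A1 : |a₁| ≤ 2 * D := by simpa using x0
  have A2 : |a₂| ≤ 2 * D := by simpa using y0
  have U1 : |T * (u - u₀)| ≤ 4 * D := by rw [abs_le] at *; constructor <;> linarith
  have U2 : |T * (v - v₀)| ≤ 4 * D := by rw [abs_le] at *; constructor <;> linarith
  have W1 : |T * (a₁ * (v + v₀) - a₂ * (u + u₀))| ≤ 64 * D ^ 2 := by
    clear U1 U2 A1 A2 x0 x1 x2 y0 y1 y2 hs1 hs2 hq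
    rw [abs_le] at *; constructor <;> nlinarith
  have W2 : |T * (a₁ * v₀ - a₂ * u₀)| ≤ 40 * D ^ 2 := by
    have k1 := abs_mul_le A1 U2
    have k2 := abs_mul_le A2 U1
    have : T * (a₁ * v₀ - a₂ * u₀) = (T * (a₁ * (v + v₀) - a₂ * (u + u₀))
      - a₁ * (T * (v - v₀)) + a₂ * (T * (u - u₀))) / 2 := by ring
    rw [this]
    clear this U1 U2 A1 A2 x0 x1 x2 y0 y1 y2 hs1 hs2 hq z0 z1 z2
    rw [abs_le] at *; constructor <;> nlinarith
  clear x0 x1 x2 y0 y1 y2 z0 z1 z2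
  set q := u₀ ^ 2 + v₀ ^ 2 with hqd
  have hqpos : 0 < q := by
    by_contra h
    push Not at h
    nlinarith [sq_nonneg (2 * M)]
  have hq2 : q ≤ (2 * M * q) ^ 2 := by nlinarith
  have r1 : |v₀ / q| ≤ 2 * M := by
    rw [abs_div, abs_of_pos hqpos, div_le_iff₀ hqpos]
    exact abs_le_of_sq_le_sq (by nlinarith [sq_nonneg u₀]) (by positivity)
  have r2 : |u₀ / q| ≤ 2 * M := by
    rw [abs_div, abs_of_pos hqpos, div_le_iff₀ hqpos]
    exact abs_le_of_sq_le_sq (by nlinarith [sq_nonneg v₀]) (by positivity)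
  set ω := a₁ * v₀ - a₂ * u₀ with hω
  set l := (a₁ * u₀ + a₂ * v₀) / q with hl
  have B1 : a₁ = l * u₀ + ω * (v₀ / q) := by
    rw [hl, hω]; field_simp; rw [hqd]; ring
  have B2 : a₂ = l * v₀ - ω * (u₀ / q) := by
    rw [hl, hω]; field_simp; rw [hqd]; ring
  set b₁ := ω * (v₀ / q) with hb₁
  set b₂ := - (ω * (u₀ / q)) with hb₂
  have B1' : |T * b₁| ≤ 80 * M * D ^ 2 := by
    have := abs_mul_le W2 r1
    rw [mul_assoc] at this
    refine this.trans (le_of_eq (by ring))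
  have B2' : |T * b₂| ≤ 80 * M * D ^ 2 := by
    have := abs_mul_le W2 r2
    rw [mul_assoc] at this
    rw [hb₂, mul_neg, abs_neg]
    refine this.trans (le_of_eq (by ring))
  refine ⟨l, c₀ - l * (u₀ * a₂ - v₀ * a₁) / 2, ?_⟩
  intro τ h1 h2
  unfold dH
  rw [Hnorm_le_iff hs.le]
  simp only [Hmul, Hinv]
  have τa : |τ| ≤ 2 * C := by rw [abs_of_nonneg h1]; exact h2
  have F1 : |b₁ + τ * (u - u₀)| ≤ s / 2 := by
    have k := abs_mul_le τa U1
    have : |T * (b₁ + τ * (u - u₀))| ≤ T * (s / 2) := by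
      rw [show T * (b₁ + τ * (u - u₀)) = T * b₁ + τ * (T * (u - u₀)) by ring]
      refine (abs_add_le _ _).trans ?_
      linarith
    rw [abs_mul, abs_of_pos hTpos] at this
    exact le_of_mul_le_mul_left this hTpos
  have F2 : |b₂ + τ * (v - v₀)| ≤ s / 2 := by
    have k := abs_mul_le τa U2
    have : |T * (b₂ + τ * (v - v₀))| ≤ T * (s / 2) := by
      rw [show T * (b₂ + τ * (v - v₀)) = T * b₂ + τ * (T * (v - v₀)) by ring]
      refine (abs_add_le _ _).trans ?_
      linarith
    rw [abs_mul, abs_of_pos hTpos] at this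
    exact le_of_mul_le_mul_left this hTpos
  have F3 : |τ * (b₁ * (v + v₀) - b₂ * (u + u₀)) / 2 - τ ^ 2 * (u₀ * v - v₀ * u) / 2| ≤ s ^ 2 := by
    have sv : |v + v₀| ≤ 2 * M := (abs_add_le _ _).trans (by linarith)
    have su : |u + u₀| ≤ 2 * M := (abs_add_le _ _).trans (by linarith)
    have k1 := abs_mul_le τa (abs_mul_le B1' sv)
    have k2 := abs_mul_le τa (abs_mul_le B2' su)
    have k3 := abs_mul_le τa (abs_mul_le τa (abs_mul_le hu₀ U2))
    have k4 := abs_mul_le τa (abs_mul_le τa (abs_mul_le hv₀ U1))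
    have : |T * (τ * (b₁ * (v + v₀) - b₂ * (u + u₀)) / 2 - τ ^ 2 * (u₀ * v - v₀ * u) / 2)| ≤ T * s ^ 2 := by
      have e : T * (τ * (b₁ * (v + v₀) - b₂ * (u + u₀)) / 2 - τ ^ 2 * (u₀ * v - v₀ * u) / 2)
        = (τ * ((T * b₁) * (v + v₀)) - τ * ((T * b₂) * (u + u₀))
          - τ * (τ * (u₀ * (T * (v - v₀)))) + τ * (τ * (v₀ * (T * (u - u₀))))) / 2 := by ring
      rw [e]
      have hfin : (2 * C * (80 * M * D ^ 2 * (2 * M)) + 2 * C * (80 * M * D ^ 2 * (2 * M))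
        + 2 * C * (2 * C * (M * (4 * D))) + 2 * C * (2 * C * (M * (4 * D)))) / 2 ≤ T * s ^ 2 := by
        linarith
      clear e hs1 hs2
      rw [abs_le] at *
      constructor <;> linarith
    rw [abs_mul, abs_of_pos hTpos] at this
    exact le_of_mul_le_mul_left this hTpos
  constructor
  · have e1 : -(l * u₀ + τ * u₀) + (a₁ + τ * u) = b₁ + τ * (u - u₀) := by rw [B1]; ring
    have e2 : -(l * v₀ + τ * v₀) + (a₂ + τ * v) = b₂ + τ * (v - v₀) := by rw [B2]; ring
    rw [e1, e2]
    have := sq_le_sq' (abs_le.1 F1).1 (abs_le.1 F1).2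
    have := sq_le_sq' (abs_le.1 F2).1 (abs_le.1 F2).2
    nlinarith
  · convert F3 using 2
    rw [show a₂ = l * v₀ + b₂ by rw [B2]; ring, B1]
    ring

set_option maxHeartbeats 1000000 in
lemma core (M ε C : ℝ) (hM : 1 ≤ M) (hε : 0 < ε) (hC : 1 ≤ C) :
    ∃ T ≥ 1, ∃ h > 0, ∃ η > 0, ∀ f : ℝ × ℝ → Hei, IsBilipschitz M f →
      (∀ y t, |y| ≤ T → |t| ≤ T ^ 2 →
        |(f (y + 2 * h, t)).1 - 2 * (f (y + h, t)).1 + (f (y, t)).1| ≤ η ∧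
        |(f (y + 2 * h, t)).2.1 - 2 * (f (y + h, t)).2.1 + (f (y, t)).2.1| ≤ η) →
      ∃ (p₀ : Hei) (u₀ v₀ : ℝ), (u₀, v₀) ≠ (0 : ℝ × ℝ) ∧ ∀ t, |t| ≤ C ^ 2 → ∃ l c, ∀ y, |y| ≤ C →
        dH (f (y, t)) (Hmul (Hmul p₀ (l * u₀, l * v₀, c)) ((y + C) * u₀, (y + C) * v₀, 0)) ≤ ε := by
  set D := M * C with hD
  have hDpos : 0 < D := by positivity
  have hD1 : 1 ≤ D := by nlinarith
  set s := ε / 2 with hs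
  have hspos : 0 < s := by positivity
  set X := 2 * (80 * M * D ^ 2 + 8 * C * D) with hX
  set Y := 320 * C * M ^ 2 * D ^ 2 + 16 * C ^ 2 * M * D with hY
  have hXpos : 0 < X := by positivity
  have hYpos : 0 < Y := by positivity
  set T := 2 * C + X / s + Y / s ^ 2 with hT
  have hX0 : 0 < X / s := by positivity
  have hY0 : 0 < Y / s ^ 2 := by positivity
  have hTC : 2 * C ≤ T := by linarith
  have hT1 : 1 ≤ T := by linarith
  have hsX : X ≤ s * T := by
    have : X = s * (X / s) := by field_simp
    rw [this]; gcongr; linarith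
  have hsY : Y ≤ s ^ 2 * T := by
    have : Y = s ^ 2 * (Y / s ^ 2) := by field_simp
    rw [this]; gcongr; linarith
  clear_value T X Y
  set δ := min (ε / 2) (1 / (4 * M)) with hδ
  have hδpos : 0 < δ := lt_min (by positivity) (by positivity)
  have hδ1 : δ ≤ s := min_le_left _ _
  have hδ2 : δ * (4 * M) ≤ 1 := by
    rw [← le_div_iff₀ (by positivity)]; exact min_le_right _ _
  clear_value δ
  have hδ3 : δ ≤ 1 / 2 := by nlinarith
  obtain ⟨h, hh, η, hη, H⟩ := curve_lemma M T δ hM hT1 hδpos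
  refine ⟨T, hT1, h, hh, η, hη, ?_⟩
  intro f hf hΔ
  have HH : ∀ t, |t| ≤ C ^ 2 → ∃ u v : ℝ, |u| ≤ M ∧ |v| ≤ M ∧ ∀ τ, 0 ≤ τ → τ ≤ T →
        dH (f (τ - C, t)) (Hmul (f (-C, t)) (τ * u, τ * v, 0)) ≤ δ := by
    intro t ht
    obtain ⟨u, v, h1, h2, h3⟩ := H (fun τ => f (τ - C, t)) (by
      intro x y
      have := (hf (x - C, t) (y - C, t)).2
      simp only [dPar, sub_self, abs_zero, Real.sqrt_zero, sub_sub_sub_cancel_right] at this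
      rwa [max_eq_left (abs_nonneg _)] at this) (by
      intro x hx0 hxT
      have := hΔ (x - C) t (by rw [abs_le]; constructor <;> linarith) (ht.trans (by gcongr; linarith))
      rw [show x - C + 2 * h = x + 2 * h - C by ring, show x - C + h = x + h - C by ring] at this
      exact this)
    refine ⟨u, v, h1, h2, ?_⟩
    simpa using h3
  obtain ⟨u₀, v₀, hu₀, hv₀, h₀⟩ := HH 0 (by rw [abs_zero]; positivity)
  have hq : 1 ≤ (u₀ ^ 2 + v₀ ^ 2) * (2 * M) ^ 2 := by
    by_contra hcon
    push Not at hcon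
    have e1 := (hf (T - C, 0) (-C, 0)).1
    simp only [dPar, sub_self, abs_zero, Real.sqrt_zero] at e1
    rw [max_eq_left (abs_nonneg _), show T - C - -C = T by ring, abs_of_pos (by linarith)] at e1
    have e2 := h₀ T (by linarith) le_rfl
    have e3 : dH (Hmul (f (-C, 0)) (T * u₀, T * v₀, 0)) (f (-C, 0)) ≤ T / (2 * M) := by
      unfold dH
      rw [Hnorm_le_iff (by positivity)]
      simp only [Hmul, Hinv]
      constructor
      · rw [div_pow, le_div_iff₀ (by positivity)]
        have : T ^ 2 * ((u₀ ^ 2 + v₀ ^ 2) * (2 * M) ^ 2) ≤ T ^ 2 * 1 := by gcongr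
        linarith
      · ring_nf; simp; positivity
    have e4 := dH_triangle (f (T - C, 0)) (Hmul (f (-C, 0)) (T * u₀, T * v₀, 0)) (f (-C, 0))
    have e5 : M⁻¹ * T ≤ δ + T / (2 * M) := by linarith
    have e6 : T ≤ δ * (2 * M) := by
      field_simp at e5
      linarith
    nlinarith
  refine ⟨f (-C, 0), u₀, v₀, ?_, ?_⟩
  · intro hz
    rw [Prod.mk_eq_zero] at hz
    rw [hz.1, hz.2] at hq
    norm_num at hq
  intro t ht
  obtain ⟨u, v, hu, hv, h₁⟩ := HH t ht
  obtain ⟨l, c, hlc⟩ := two_lines M C D T s hM hC hDpos hT1 hspos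
    (by rw [← hX]; exact hsX) (by rw [← hY]; exact hsY) (f (-C, t)) (f (-C, 0)) u v u₀ v₀
    hu hv hu₀ hv₀ hq (by
      intro τ h1 h2
      have a1 := h₁ τ h1 h2
      have a2 := h₀ τ h1 h2
      have a3 := (hf (τ - C, t) (τ - C, 0)).2
      have a4 : dPar (τ - C, t) (τ - C, 0) ≤ C := by
        simp only [dPar, sub_self, abs_zero, sub_zero]
        refine max_le (by linarith) ?_
        rw [Real.sqrt_le_left (by linarith)]; exact ht
      have a5 : M * dPar (τ - C, t) (τ - C, 0) ≤ D := by rw [hD]; gcongr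
      rw [dH_comm] at a1
      have b1 := dH_triangle (Hmul (f (-C, t)) (τ * u, τ * v, 0)) (f (τ - C, t))
        (Hmul (f (-C, 0)) (τ * u₀, τ * v₀, 0))
      have b2 := dH_triangle (f (τ - C, t)) (f (τ - C, 0))
        (Hmul (f (-C, 0)) (τ * u₀, τ * v₀, 0))
      linarith)
  refine ⟨l, c, ?_⟩
  intro y hy
  rw [abs_le] at hy
  have a1 := h₁ (y + C) (by linarith) (by linarith)
  have a2 := hlc (y + C) (by linarith) (by linarith)
  rw [add_sub_cancel_right] at a1
  have := dH_triangle (f (y, t)) (Hmul (f (-C, t)) ((y + C) * u, (y + C) * v, 0))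
    (Hmul (Hmul (f (-C, 0)) (l * u₀, l * v₀, c)) ((y + C) * u₀, (y + C) * v₀, 0))
  linarith

lemma dPar_scale (r : ℝ) (hr : 0 < r) (c w w' : ℝ × ℝ) :
    dPar (c.1 + r * w.1, c.2 + r ^ 2 * w.2) (c.1 + r * w'.1, c.2 + r ^ 2 * w'.2) = r * dPar w w' := by
  simp only [dPar]
  rw [show c.1 + r * w.1 - (c.1 + r * w'.1) = r * (w.1 - w'.1) by ring,
    show c.2 + r ^ 2 * w.2 - (c.2 + r ^ 2 * w'.2) = r ^ 2 * (w.2 - w'.2) by ring, abs_mul, abs_mul,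
    abs_of_pos hr, abs_of_pos (by positivity : 0 < r ^ 2), Real.sqrt_mul (by positivity),
    Real.sqrt_sq hr.le, mul_max_of_nonneg _ _ hr.le]

lemma mem_NH {p q : Hei} {L : Set Hei} {δ : ℝ} (hq : q ∈ L) (h : dH p q ≤ δ) : p ∈ NH L δ := by
  have hb : BddBelow (dH p '' L) := by
    refine ⟨0, ?_⟩
    rintro _ ⟨z, _, rfl⟩
    exact dH_nonneg _ _
  have : distH p L ≤ dH p q := csInf_le hb (Set.mem_image_of_mem _ hq)
  exact this.trans h

lemma betaV_nonneg (f : ℝ × ℝ → Hei) (V : Set Hei) (w : ℝ × ℝ) (r : ℝ) : 0 ≤ betaV f V w r :=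
  Real.sInf_nonneg fun _ hx => hx.1.le

lemma beta_le {f : ℝ × ℝ → Hei} {V : Set Hei} {w : ℝ × ℝ} {r ε : ℝ} (hε : 0 < ε)
    (hV : IsVerticalPlane V)
    (h : ∀ t : ℝ, ∃ L : Set Hei, IsHorizontalLine L ∧ L ⊆ V ∧
      f '' (lineW t ∩ BPar w r) ⊆ NH L (ε * r)) : beta f w r ≤ ε := by
  refine le_trans (csInf_le ⟨0, ?_⟩ ⟨V, hV, rfl⟩) (csInf_le ⟨0, fun x hx => hx.1.le⟩ ⟨hε, h⟩)
  rintro _ ⟨V, _, rfl⟩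
  exact betaV_nonneg _ _ _ _

set_option maxHeartbeats 1000000 in
lemma beta_small (M ε C : ℝ) (hM : 1 ≤ M) (hε : 0 < ε) (hC : 1 ≤ C) :
    ∃ T ≥ 1, ∃ h > 0, ∃ η > 0, ∀ f : ℝ × ℝ → Hei, IsBilipschitz M f → ∀ (a b r : ℝ), 0 < r →
      (∀ y t, |y - a| ≤ T * r → |t - b| ≤ (T * r) ^ 2 →
        |(f (y + 2 * (h * r), t)).1 - 2 * (f (y + h * r, t)).1 + (f (y, t)).1| ≤ η * r ∧
        |(f (y + 2 * (h * r), t)).2.1 - 2 * (f (y + h * r, t)).2.1 + (f (y, t)).2.1| ≤ η * r) →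
      beta f (a, b) (C * r) < ε := by
  obtain ⟨T, hT, h, hh, η, hη, H⟩ := core M (ε / 2) C hM (by positivity) hC
  refine ⟨T, hT, h, hh, η, hη, ?_⟩
  intro f hf a b r hr hΔ
  have hrinv : 0 < r⁻¹ := by positivity
  obtain ⟨p₀, u₀, v₀, huv, K⟩ := H (fun w => Hdil r⁻¹ (f (a + r * w.1, b + r ^ 2 * w.2))) (by
      intro w w'
      simp only
      rw [dH_dil hrinv.le]
      have := hf (a + r * w.1, b + r ^ 2 * w.2) (a + r * w'.1, b + r ^ 2 * w'.2)
      rw [dPar_scale r hr (a, b)] at this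
      obtain ⟨h1, h2⟩ := this
      constructor
      · calc M⁻¹ * dPar w w' = r⁻¹ * (M⁻¹ * (r * dPar w w')) := by field_simp
          _ ≤ _ := by gcongr
      · calc _ ≤ r⁻¹ * (M * (r * dPar w w')) := by gcongr
          _ = _ := by field_simp) (by
      intro y t hy ht
      simp only [Hdil]
      have := hΔ (a + r * y) (b + r ^ 2 * t)
        (by rw [add_sub_cancel_left, abs_mul, abs_of_pos hr, mul_comm]; gcongr)
        (by rw [add_sub_cancel_left, abs_mul, abs_of_pos (by positivity), mul_pow, mul_comm]; gcongr)
      rw [show a + r * y + 2 * (h * r) = a + r * (y + 2 * h) by ring,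
        show a + r * y + h * r = a + r * (y + h) by ring] at this
      obtain ⟨h1, h2⟩ := this
      constructor
      · rw [show ∀ x y z : ℝ, r⁻¹ * x - 2 * (r⁻¹ * y) + r⁻¹ * z = r⁻¹ * (x - 2 * y + z) by
          intros; ring, abs_mul, abs_of_pos hrinv]
        rw [inv_mul_le_iff₀ hr]; linarith
      · rw [show ∀ x y z : ℝ, r⁻¹ * x - 2 * (r⁻¹ * y) + r⁻¹ * z = r⁻¹ * (x - 2 * y + z) by
          intros; ring, abs_mul, abs_of_pos hrinv]
        rw [inv_mul_le_iff₀ hr]; linarith)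
  set P := Hdil r p₀ with hP
  set L₀ : Set Hei := {q | ∃ s : ℝ, q = Hmul P (s * (u₀, v₀).1, s * (u₀, v₀).2, 0)} with hL₀
  have hL₀h : IsHorizontalLine L₀ := ⟨P, (u₀, v₀), huv, rfl⟩
  refine lt_of_le_of_lt (beta_le (V := VSpan L₀) (ε := ε / 2) (by positivity) ⟨L₀, hL₀h, rfl⟩ ?_)
    (by linarith)
  intro t
  by_cases ht : |t - b| ≤ (C * r) ^ 2
  · obtain ⟨l, c, hlc⟩ := K ((t - b) / r ^ 2) (by
      rw [abs_div, abs_of_pos (by positivity : 0 < r ^ 2), div_le_iff₀ (by positivity)]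
      linarith)
    refine ⟨{q | ∃ s : ℝ, q = Hmul (Hmul P (r * l * u₀, r * l * v₀, r ^ 2 * c)) (s * (u₀, v₀).1, s * (u₀, v₀).2, 0)},
      ⟨_, (u₀, v₀), huv, rfl⟩, ?_, ?_⟩
    · rintro _ ⟨s, rfl⟩
      refine ⟨_, ⟨r * l + s, rfl⟩, r ^ 2 * c, ?_⟩
      rw [Hmul_assoc, Hmul_assoc]
      congr 1
      simp only [Hmul, Prod.mk.injEq]
      refine ⟨by ring, by ring, by ring⟩
    · rintro _ ⟨⟨y, t'⟩, ⟨ht', hB⟩, rfl⟩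
      simp only [lineW, Set.mem_ofPred_eq] at ht'
      subst ht'
      have hy : |y - a| ≤ C * r := (le_max_left _ _).trans hB
      have := hlc ((y - a) / r) (by
        rw [abs_div, abs_of_pos hr, div_le_iff₀ hr]; exact hy)
      simp only at this
      rw [show a + r * ((y - a) / r) = y by field_simp; ring,
        show b + r ^ 2 * ((t' - b) / r ^ 2) = t' by field_simp; ring] at this
      refine mem_NH ⟨r * ((y - a) / r + C), rfl⟩ ?_
      have h2 := mul_le_mul_of_nonneg_left this hr.le
      rw [← dH_dil hr.le, Hdil_dil hr.ne', Hdil_mul, Hdil_mul] at h2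
      simp only [Hdil, mul_zero] at h2
      simp only [hP, Hdil]
      simp only [← mul_assoc] at h2 ⊢
      refine h2.trans ?_
      have h3 : r * (ε / 2) * 1 ≤ r * (ε / 2) * C := by gcongr
      linarith
  · refine ⟨L₀, hL₀h, ?_, ?_⟩
    · rintro q hq
      refine ⟨q, hq, 0, ?_⟩
      simp [Hmul]
    · rintro _ ⟨⟨y, t'⟩, ⟨ht', hB⟩, rfl⟩
      simp only [lineW, Set.mem_ofPred_eq] at ht'
      subst ht'
      exfalso
      apply ht
      have : Real.sqrt |t' - b| ≤ C * r := (le_max_right _ _).trans hB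
      rwa [Real.sqrt_le_left (by positivity)] at this

lemma energy_step (F : ℝ → ℝ) (M : ℝ) (hM : 0 ≤ M) (hF : ∀ x y, |F x - F y| ≤ M * |x - y|)
    (hc : Continuous F) (A B h : ℝ) (hAB : A ≤ B) (hh : 0 < h) :
    ∫ x in A..B, (F (x + 2 * h) - 2 * F (x + h) + F x) ^ 2 / h ^ 2 ≤
      4 * (∫ x in A..B, (F (x + h) - F x) ^ 2 / h ^ 2)
      - 4 * (∫ x in A..B, (F (x + 2 * h) - F x) ^ 2 / (2 * h) ^ 2) + 2 * M ^ 2 * h := by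
  have i1 : ∀ a b, IntervalIntegrable (fun x => (F (x + h) - F x) ^ 2 / h ^ 2) MeasureTheory.volume a b :=
    fun a b => Continuous.intervalIntegrable (by fun_prop) _ _
  have i2 : ∀ a b, IntervalIntegrable (fun x => (F (x + h + h) - F (x + h)) ^ 2 / h ^ 2) MeasureTheory.volume a b :=
    fun a b => Continuous.intervalIntegrable (by fun_prop) _ _
  have i3 : ∀ a b, IntervalIntegrable (fun x => (F (x + 2 * h) - F x) ^ 2 / (2 * h) ^ 2) MeasureTheory.volume a b :=
    fun a b => Continuous.intervalIntegrable (by fun_prop) _ _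
  have e1 : ∫ x in A..B, (F (x + 2 * h) - 2 * F (x + h) + F x) ^ 2 / h ^ 2 =
      2 * (∫ x in A..B, (F (x + h) - F x) ^ 2 / h ^ 2)
      + 2 * (∫ x in A..B, (F (x + h + h) - F (x + h)) ^ 2 / h ^ 2)
      - 4 * (∫ x in A..B, (F (x + 2 * h) - F x) ^ 2 / (2 * h) ^ 2) := by
    rw [← intervalIntegral.integral_const_mul, ← intervalIntegral.integral_const_mul,
      ← intervalIntegral.integral_const_mul, ← intervalIntegral.integral_add
      ((i1 A B).const_mul 2) ((i2 A B).const_mul 2), ← intervalIntegral.integral_sub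
      (((i1 A B).const_mul 2).add ((i2 A B).const_mul 2)) ((i3 A B).const_mul 4)]
    congr 1
    ext x
    rw [show x + h + h = x + 2 * h by ring]
    field_simp
    ring
  have e2 : ∫ x in A..B, (F (x + h + h) - F (x + h)) ^ 2 / h ^ 2 =
      ∫ x in (A + h)..(B + h), (F (x + h) - F x) ^ 2 / h ^ 2 :=
    intervalIntegral.integral_comp_add_right (fun x => (F (x + h) - F x) ^ 2 / h ^ 2) h
  have e3 := intervalIntegral.integral_add_adjacent_intervals (i1 A (A + h)) (i1 (A + h) (B + h))
  have e4 := intervalIntegral.integral_add_adjacent_intervals (i1 A B) (i1 B (B + h))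
  have e5 : 0 ≤ ∫ x in A..(A + h), (F (x + h) - F x) ^ 2 / h ^ 2 :=
    intervalIntegral.integral_nonneg (by linarith) (fun x _ => by positivity)
  have e6 : ∫ x in B..(B + h), (F (x + h) - F x) ^ 2 / h ^ 2 ≤ ∫ x in B..(B + h), M ^ 2 := by
    refine intervalIntegral.integral_mono_on (by linarith) (i1 _ _) (by simp) ?_
    intro x _
    rw [div_le_iff₀ (by positivity), ← mul_pow]
    have := hF (x + h) x
    rw [add_sub_cancel_left, abs_of_pos hh] at this
    exact sq_le_sq' (abs_le.1 this).1 (abs_le.1 this).2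
  rw [intervalIntegral.integral_const, add_sub_cancel_left, smul_eq_mul] at e6
  rw [e1, e2]
  linarith

lemma energy_sum (F : ℝ → ℝ) (M : ℝ) (hM : 0 ≤ M) (hF : ∀ x y, |F x - F y| ≤ M * |x - y|)
    (hc : Continuous F) (A B h : ℝ) (hAB : A ≤ B) (hh : 0 < h) (m : ℕ) :
    ∑ j ∈ Finset.range m, ∫ x in A..B,
      (F (x + 2 * (h / 2 ^ j)) - 2 * F (x + h / 2 ^ j) + F x) ^ 2 / (h / 2 ^ j) ^ 2 ≤
      4 * M ^ 2 * (B - A + h) := by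
  have key : ∑ j ∈ Finset.range m, ∫ x in A..B,
      (F (x + 2 * (h / 2 ^ j)) - 2 * F (x + h / 2 ^ j) + F x) ^ 2 / (h / 2 ^ j) ^ 2 ≤
      4 * (∫ x in A..B, (F (x + 2 * (h / 2 ^ m)) - F x) ^ 2 / (2 * (h / 2 ^ m)) ^ 2)
      - 4 * (∫ x in A..B, (F (x + 2 * h) - F x) ^ 2 / (2 * h) ^ 2)
      + 4 * M ^ 2 * (h - h / 2 ^ m) := by
    induction m with
    | zero => simp
    | succ m ih =>
      rw [Finset.sum_range_succ]
      have := energy_step F M hM hF hc A B (h / 2 ^ m) hAB (by positivity)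
      rw [show 2 * (h / 2 ^ (m + 1)) = h / 2 ^ m by rw [pow_succ]; field_simp,
        show h / 2 ^ (m + 1) = h / 2 ^ m / 2 by rw [pow_succ]; field_simp]
      linarith
  have e5 : 0 ≤ ∫ x in A..B, (F (x + 2 * h) - F x) ^ 2 / (2 * h) ^ 2 :=
    intervalIntegral.integral_nonneg (by linarith) (fun x _ => by positivity)
  set k := 2 * (h / 2 ^ m) with hk
  have hkpos : 0 < k := by positivity
  have e6 : ∫ x in A..B, (F (x + k) - F x) ^ 2 / k ^ 2 ≤ ∫ x in A..B, M ^ 2 := by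
    refine intervalIntegral.integral_mono_on (by linarith)
      (Continuous.intervalIntegrable (by fun_prop) _ _) (by simp) ?_
    intro x _
    rw [div_le_iff₀ (by positivity), ← mul_pow]
    have := hF (x + k) x
    rw [add_sub_cancel_left, abs_of_pos hkpos] at this
    exact sq_le_sq' (abs_le.1 this).1 (abs_le.1 this).2
  rw [intervalIntegral.integral_const, smul_eq_mul] at e6
  have : 0 ≤ 4 * M ^ 2 * (h / 2 ^ m) := by positivity
  linarith

/-- sum of squares of second differences -/
noncomputable def SS (f : ℝ × ℝ → Hei) (h : ℝ) (w : ℝ × ℝ) : ℝ :=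
  ((f (w.1 + 2 * h, w.2)).1 - 2 * (f (w.1 + h, w.2)).1 + (f w).1) ^ 2 +
  ((f (w.1 + 2 * h, w.2)).2.1 - 2 * (f (w.1 + h, w.2)).2.1 + (f w).2.1) ^ 2

lemma lip_comp {M : ℝ} (hM : 1 ≤ M) {f : ℝ × ℝ → Hei} (hf : IsBilipschitz M f) (w w' : ℝ × ℝ) :
    |(f w).1 - (f w').1| ≤ M * dPar w w' ∧ |(f w).2.1 - (f w').2.1| ≤ M * dPar w w' := by
  have h0 : 0 ≤ dPar w w' := (abs_nonneg _).trans (le_max_left _ _)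
  have h2 := ((Hnorm_le_iff (by positivity)).1 (hf w w').2).1
  simp only [Hmul, Hinv] at h2
  have := abs_le_of_sq_add (by positivity) h2
  rwa [neg_add_eq_sub, neg_add_eq_sub] at this

lemma cont_of_lip {M : ℝ} {g : ℝ × ℝ → ℝ} (hg : ∀ w w', |g w - g w'| ≤ M * dPar w w') : Continuous g := by
  rw [continuous_iff_continuousAt]
  intro w₀
  rw [ContinuousAt, tendsto_iff_dist_tendsto_zero]
  have hc : Continuous (fun w => M * dPar w w₀) := by unfold dPar; fun_prop
  have h0 : M * dPar w₀ w₀ = 0 := by simp [dPar]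
  have := hc.tendsto w₀
  rw [h0] at this
  exact squeeze_zero (fun _ => dist_nonneg) (fun w => by rw [Real.dist_eq]; exact hg w w₀) this

lemma SS_cont {M : ℝ} (hM : 1 ≤ M) {f : ℝ × ℝ → Hei} (hf : IsBilipschitz M f) (h : ℝ) :
    Continuous (SS f h) := by
  have h1 := cont_of_lip (fun w w' => (lip_comp hM hf w w').1)
  have h2 := cont_of_lip (fun w w' => (lip_comp hM hf w w').2)
  unfold SS
  have s1 : Continuous (fun w : ℝ × ℝ => (w.1 + 2 * h, w.2)) := by fun_prop
  have s2 : Continuous (fun w : ℝ × ℝ => (w.1 + h, w.2)) := by fun_prop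
  have a1 := h1.comp s1
  have a2 := h1.comp s2
  have b1 := h2.comp s1
  have b2 := h2.comp s2
  simp only [Function.comp_def] at a1 a2 b1 b2
  exact (((a1.sub (a2.const_mul 2)).add h1).pow 2).add (((b1.sub (b2.const_mul 2)).add h2).pow 2)

open MeasureTheory in
lemma energy_two {M : ℝ} (hM : 1 ≤ M) {f : ℝ × ℝ → Hei} (hf : IsBilipschitz M f)
    (A B T₁ T₂ h : ℝ) (hAB : A ≤ B) (hh : 0 < h) (m : ℕ) :
    ∑ j ∈ Finset.range m, ∫⁻ w in Set.Icc A B ×ˢ Set.Icc T₁ T₂,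
      ENNReal.ofReal (SS f (h / 2 ^ j) w / (h / 2 ^ j) ^ 2) ≤
    ENNReal.ofReal (8 * M ^ 2 * (B - A + h)) * ENNReal.ofReal (T₂ - T₁) := by
  have hcont : ∀ j : ℕ, Continuous (fun w => SS f (h / 2 ^ j) w / (h / 2 ^ j) ^ 2) :=
    fun j => (SS_cont hM hf _).div_const _
  have h1 : ∀ j : ℕ, ∫⁻ w in Set.Icc A B ×ˢ Set.Icc T₁ T₂,
      ENNReal.ofReal (SS f (h / 2 ^ j) w / (h / 2 ^ j) ^ 2) =
      ∫⁻ t in Set.Icc T₁ T₂, ∫⁻ y in Set.Icc A B,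
        ENNReal.ofReal (SS f (h / 2 ^ j) (y, t) / (h / 2 ^ j) ^ 2) := by
    intro j
    rw [Measure.volume_eq_prod, ← Measure.prod_restrict, lintegral_prod_symm]
    exact (ENNReal.measurable_ofReal.comp (hcont j).measurable).aemeasurable
  simp only [h1]
  have hmeas : ∀ j : ℕ, Measurable (fun t => ∫⁻ y in Set.Icc A B,
        ENNReal.ofReal (SS f (h / 2 ^ j) (y, t) / (h / 2 ^ j) ^ 2)) := by
    intro j
    exact Measurable.lintegral_prod_left' (f := fun w : ℝ × ℝ => ENNReal.ofReal (SS f (h / 2 ^ j) w / (h / 2 ^ j) ^ 2))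
      (ENNReal.measurable_ofReal.comp (hcont j).measurable)
  rw [← lintegral_finsetSum _ (fun j _ => hmeas j)]
  have hin : ∀ t, ∑ j ∈ Finset.range m, ∫⁻ y in Set.Icc A B,
        ENNReal.ofReal (SS f (h / 2 ^ j) (y, t) / (h / 2 ^ j) ^ 2) ≤
        ENNReal.ofReal (8 * M ^ 2 * (B - A + h)) := by
    intro t
    have hct : ∀ j : ℕ, Continuous (fun y => SS f (h / 2 ^ j) (y, t) / (h / 2 ^ j) ^ 2) :=
      fun j => (hcont j).comp (by fun_prop)
    have h2 : ∀ j : ℕ, ∫⁻ y in Set.Icc A B,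
        ENNReal.ofReal (SS f (h / 2 ^ j) (y, t) / (h / 2 ^ j) ^ 2) =
        ENNReal.ofReal (∫ y in A..B, SS f (h / 2 ^ j) (y, t) / (h / 2 ^ j) ^ 2) := by
      intro j
      rw [intervalIntegral.integral_of_le hAB, ← integral_Icc_eq_integral_Ioc,
        ofReal_integral_eq_lintegral_ofReal]
      · exact (hct j).integrableOn_Icc
      · exact Filter.Eventually.of_forall (fun y => by simp only [SS]; positivity)
    simp only [h2]
    rw [← ENNReal.ofReal_sum_of_nonneg]
    · apply ENNReal.ofReal_le_ofReal
      have dp : ∀ x y : ℝ, dPar (x, t) (y, t) = |x - y| := by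
        intro x y; simp [dPar]
      have c1 := cont_of_lip (fun w w' => (lip_comp hM hf w w').1)
      have c2 := cont_of_lip (fun w w' => (lip_comp hM hf w w').2)
      have k1 : Continuous (fun x : ℝ => (f (x, t)).1) := c1.comp (by fun_prop : Continuous fun x : ℝ => (x, t))
      have k2 : Continuous (fun x : ℝ => (f (x, t)).2.1) := c2.comp (by fun_prop : Continuous fun x : ℝ => (x, t))
      have g1 := energy_sum (fun x => (f (x, t)).1) M (by linarith)
        (fun x y => by rw [← dp x y]; exact (lip_comp hM hf (x, t) (y, t)).1)
        k1 A B h hAB hh m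
      have g2 := energy_sum (fun x => (f (x, t)).2.1) M (by linarith)
        (fun x y => by rw [← dp x y]; exact (lip_comp hM hf (x, t) (y, t)).2)
        k2 A B h hAB hh m
      have : ∀ j ∈ Finset.range m, ∫ y in A..B, SS f (h / 2 ^ j) (y, t) / (h / 2 ^ j) ^ 2 =
        (∫ x in A..B, ((f (x + 2 * (h / 2 ^ j), t)).1 - 2 * (f (x + h / 2 ^ j, t)).1 + (f (x, t)).1) ^ 2 / (h / 2 ^ j) ^ 2) +
        ∫ x in A..B, ((f (x + 2 * (h / 2 ^ j), t)).2.1 - 2 * (f (x + h / 2 ^ j, t)).2.1 + (f (x, t)).2.1) ^ 2 / (h / 2 ^ j) ^ 2 := by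
        intro j _
        have q1 := k1.comp (by fun_prop : Continuous fun x : ℝ => x + 2 * (h / 2 ^ j))
        have q2 := k1.comp (by fun_prop : Continuous fun x : ℝ => x + (h / 2 ^ j))
        have q3 := k2.comp (by fun_prop : Continuous fun x : ℝ => x + 2 * (h / 2 ^ j))
        have q4 := k2.comp (by fun_prop : Continuous fun x : ℝ => x + (h / 2 ^ j))
        simp only [Function.comp_def] at q1 q2 q3 q4
        rw [← intervalIntegral.integral_add]
        · congr 1
          ext x
          simp only [SS]
          rw [add_div]
        · exact ((((q1.sub (q2.const_mul 2)).add k1).pow 2).div_const _).intervalIntegrable _ _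
        · exact ((((q3.sub (q4.const_mul 2)).add k2).pow 2).div_const _).intervalIntegrable _ _
      rw [Finset.sum_congr rfl this, Finset.sum_add_distrib]
      linarith
    · intro j _
      exact intervalIntegral.integral_nonneg hAB (fun y _ => by simp only [SS]; positivity)
  calc _ ≤ ∫⁻ t in Set.Icc T₁ T₂, ENNReal.ofReal (8 * M ^ 2 * (B - A + h)) := lintegral_mono hin
    _ = _ := by rw [setLIntegral_const, Real.volume_Icc]

lemma sideLen_pos (i : Idx) : 0 < sideLen i := by unfold sideLen; positivity

lemma four_zpow (n : ℤ) : (4 : ℝ) ^ n = ((2 : ℝ) ^ n) ^ 2 := by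
  rw [← zpow_natCast, ← zpow_mul, mul_comm, zpow_mul]; norm_num

lemma mem_rect {i : Idx} {w : ℝ × ℝ} : w ∈ rect i ↔
    (i.2.1 * sideLen i ≤ w.1 ∧ w.1 < (i.2.1 + 1) * sideLen i) ∧
    (i.2.2 * sideLen i ^ 2 ≤ w.2 ∧ w.2 < (i.2.2 + 1) * sideLen i ^ 2) := by
  unfold rect sideLen
  rw [four_zpow]
  rfl

lemma center_eq (i : Idx) : center i = ((i.2.1 + 1 / 2) * sideLen i, (i.2.2 + 1 / 2) * sideLen i ^ 2) := by
  unfold center sideLen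
  rw [four_zpow]

lemma center_mem (i : Idx) : center i ∈ rect i := by
  have := sideLen_pos i
  have h2 : 0 < sideLen i ^ 2 := by positivity
  rw [mem_rect, center_eq]
  refine ⟨⟨?_, ?_⟩, ?_, ?_⟩ <;> simp only <;> nlinarith

lemma exists_cell (n : ℤ) (w : ℝ × ℝ) : ∃ q : Idx, q.1 = n ∧ w ∈ rect q := by
  have hr : (0 : ℝ) < 2 ^ (-n) := by positivity
  refine ⟨(n, ⌊w.1 / 2 ^ (-n)⌋, ⌊w.2 / (2 ^ (-n)) ^ 2⌋), rfl, ?_⟩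
  rw [mem_rect]
  simp only [sideLen]
  refine ⟨⟨?_, ?_⟩, ?_, ?_⟩
  · rw [← le_div_iff₀ hr]; exact Int.floor_le _
  · rw [← div_lt_iff₀ hr]; exact Int.lt_floor_add_one _
  · rw [← le_div_iff₀ (by positivity)]; exact Int.floor_le _
  · rw [← div_lt_iff₀ (by positivity)]; exact Int.lt_floor_add_one _

lemma rect_disjoint {q q' : Idx} (h : q.1 = q'.1) (hne : q ≠ q') : Disjoint (rect q) (rect q') := by
  rw [Set.disjoint_left]
  intro w hw hw'
  rw [mem_rect] at hw hw'
  have hs : sideLen q' = sideLen q := by unfold sideLen; rw [h]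
  rw [hs] at hw'
  have hr := sideLen_pos q
  have hr2 : 0 < sideLen q ^ 2 := by positivity
  obtain ⟨⟨a1, a2⟩, a3, a4⟩ := hw
  obtain ⟨⟨b1, b2⟩, b3, b4⟩ := hw'
  have c1 : (q.2.1 : ℝ) < q'.2.1 + 1 := lt_of_mul_lt_mul_right (a1.trans_lt b2) hr.le
  have c2 : (q'.2.1 : ℝ) < q.2.1 + 1 := lt_of_mul_lt_mul_right (b1.trans_lt a2) hr.le
  have c3 : (q.2.2 : ℝ) < q'.2.2 + 1 := lt_of_mul_lt_mul_right (a3.trans_lt b4) hr2.le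
  have c4 : (q'.2.2 : ℝ) < q.2.2 + 1 := lt_of_mul_lt_mul_right (b3.trans_lt a4) hr2.le
  norm_cast at c1 c2 c3 c4
  apply hne
  refine Prod.ext h (Prod.ext ?_ ?_) <;> omega

open MeasureTheory in
lemma volume_rect (q : Idx) : volume (rect q) = ENNReal.ofReal (sideLen q ^ 3) := by
  have := sideLen_pos q
  unfold rect
  rw [Measure.volume_eq_prod, Measure.prod_prod, Real.volume_Ico, Real.volume_Ico, four_zpow,
    ← ENNReal.ofReal_mul]
  · congr 1
    unfold sideLen
    ring
  · unfold sideLen at this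
    nlinarith

lemma measurableSet_rect (q : Idx) : MeasurableSet (rect q) :=
  measurableSet_Ico.prod measurableSet_Ico

set_option maxHeartbeats 1000000 in
lemma bad_cell (M ε C : ℝ) (hM : 1 ≤ M) (hε : 0 < ε) (hC : 1 ≤ C) :
    ∃ T ≥ (1 : ℝ), ∃ h > 0, ∃ κ > 0, ∃ P : ℕ, ∀ f : ℝ × ℝ → Hei, IsBilipschitz M f → ∀ i : Idx,
      ε ≤ beta f (center i) (C * sideLen i) → ∃ q : Idx, q.1 = i.1 + P ∧ ∀ w ∈ rect q,
        |w.1 - (center i).1| ≤ T * sideLen i ∧ |w.2 - (center i).2| ≤ T * sideLen i ^ 2 ∧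
        κ ≤ SS f (h * sideLen i) w / (h * sideLen i) ^ 2 := by
  obtain ⟨T, hT, h, hh, η, hη, H⟩ := beta_small M ε C hM hε hC
  obtain ⟨P, hP⟩ := exists_pow_lt_of_lt_one (show 0 < η / (8 * M) by positivity)
    (show (1 / 2 : ℝ) < 1 by norm_num)
  refine ⟨T ^ 2 + 1, by nlinarith, h, hh, η ^ 2 / (4 * h ^ 2), by positivity, P, ?_⟩
  intro f hf i hi
  set r := sideLen i with hr
  have hrpos : 0 < r := sideLen_pos i
  by_contra hcon
  have := H f hf (center i).1 (center i).2 r hrpos ?_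
  · exact absurd hi (not_le.2 this)
  intro y t hy ht
  by_contra hbad
  apply hcon
  obtain ⟨q, hq, hmem⟩ := exists_cell (i.1 + P) (y, t)
  have hsq : sideLen q = (1 / 2) ^ P * r := by
    rw [hr]; unfold sideLen; rw [hq, neg_add, zpow_add₀ (by norm_num)]
    rw [zpow_neg _ (P : ℤ), zpow_natCast, one_div, inv_pow]; ring
  refine ⟨q, hq, ?_⟩
  intro w hw
  have hsle : sideLen q ≤ r := by
    rw [hsq]
    have : ((1 : ℝ) / 2) ^ P ≤ 1 := pow_le_one₀ (by norm_num) (by norm_num)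
    nlinarith
  have hsle2 : sideLen q * (8 * M) ≤ η * r := by
    rw [hsq]
    rw [lt_div_iff₀ (by positivity)] at hP
    nlinarith
  have hsp := sideLen_pos q
  have hd1 : |w.1 - y| ≤ sideLen q := by
    rw [mem_rect] at hw hmem
    simp only at hmem
    rw [abs_le]; constructor <;> linarith [hw.1.1, hw.1.2, hmem.1.1, hmem.1.2]
  have hd2 : |w.2 - t| ≤ sideLen q ^ 2 := by
    rw [mem_rect] at hw hmem
    simp only at hmem
    rw [abs_le]; constructor <;> linarith [hw.2.1, hw.2.2, hmem.2.1, hmem.2.2]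
  have hsle3 : sideLen q ^ 2 ≤ r ^ 2 := by gcongr
  refine ⟨?_, ?_, ?_⟩
  · have : T * r ≤ T ^ 2 * r := by gcongr; nlinarith
    rw [abs_le] at *
    constructor <;> linarith
  · rw [abs_le] at *
    constructor <;> linarith
  · have hdp : ∀ s : ℝ, dPar (w.1 + s, w.2) (y + s, t) ≤ sideLen q := by
      intro s
      simp only [dPar]
      refine max_le (by simpa using hd1) ?_
      rw [Real.sqrt_le_left hsp.le]; exact hd2
    have hl : ∀ s : ℝ, |(f (w.1 + s, w.2)).1 - (f (y + s, t)).1| ≤ η * r / 8 ∧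
        |(f (w.1 + s, w.2)).2.1 - (f (y + s, t)).2.1| ≤ η * r / 8 := by
      intro s
      have h1 := lip_comp hM hf (w.1 + s, w.2) (y + s, t)
      have h2 : M * dPar (w.1 + s, w.2) (y + s, t) ≤ η * r / 8 := by
        have : M * dPar (w.1 + s, w.2) (y + s, t) ≤ M * sideLen q := by gcongr; exact hdp s
        linarith
      exact ⟨h1.1.trans h2, h1.2.trans h2⟩
    obtain ⟨x0, y0⟩ := hl 0
    obtain ⟨x1, y1⟩ := hl (h * r)
    obtain ⟨x2, y2⟩ := hl (2 * (h * r))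
    simp only [add_zero] at x0 y0
    rw [le_div_iff₀ (by positivity)]
    have : η ^ 2 / (4 * h ^ 2) * (h * r) ^ 2 = (η * r / 2) ^ 2 := by field_simp; ring
    rw [this]
    unfold SS
    have hηr : 0 < η * r := by positivity
    rw [not_and_or, not_le, not_le] at hbad
    rcases hbad with hb | hb
    · refine le_add_of_le_of_nonneg ?_ (sq_nonneg _)
      rw [← sq_abs (_ + _)]
      gcongr
      rw [show w = (w.1, w.2) from rfl] at *
      simp only at *
      generalize (f (w.1 + 2 * (h * r), w.2)).1 = A2 at *
      generalize (f (w.1 + h * r, w.2)).1 = A1 at *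
      generalize (f (w.1, w.2)).1 = A0 at *
      have := abs_sub_abs_le_abs_sub ((f (y + 2 * (h * r), t)).1 - 2 * (f (y + h * r, t)).1 + (f (y, t)).1) (A2 - 2 * A1 + A0)
      have h3 : |(f (y + 2 * (h * r), t)).1 - 2 * (f (y + h * r, t)).1 + (f (y, t)).1 - (A2 - 2 * A1 + A0)| ≤ η * r / 2 := by
        clear this hb
        rw [abs_le] at *
        constructor <;> linarith
      linarith
    · refine le_add_of_nonneg_of_le (sq_nonneg _) ?_
      rw [← sq_abs (_ + _)]
      gcongr
      rw [show w = (w.1, w.2) from rfl] at *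
      simp only at *
      generalize (f (w.1 + 2 * (h * r), w.2)).2.1 = A2 at *
      generalize (f (w.1 + h * r, w.2)).2.1 = A1 at *
      generalize (f (w.1, w.2)).2.1 = A0 at *
      have := abs_sub_abs_le_abs_sub ((f (y + 2 * (h * r), t)).2.1 - 2 * (f (y + h * r, t)).2.1 + (f (y, t)).2.1) (A2 - 2 * A1 + A0)
      have h3 : |(f (y + 2 * (h * r), t)).2.1 - 2 * (f (y + h * r, t)).2.1 + (f (y, t)).2.1 - (A2 - 2 * A1 + A0)| ≤ η * r / 2 := by
        clear this hb
        rw [abs_le] at *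
        constructor <;> linarith
      linarith

lemma card_Icc_le (x T : ℝ) (N : ℕ) (hN : 2 * T + 1 ≤ N) :
    (Finset.Icc ⌈x - T⌉ ⌊x + T⌋).card ≤ N := by
  rw [Int.card_Icc, Int.toNat_le]
  have h1 := Int.floor_le (x + T)
  have h2 := Int.le_ceil (x - T)
  have : ((⌊x + T⌋ + 1 - ⌈x - T⌉ : ℤ) : ℝ) ≤ ((N : ℤ) : ℝ) := by push_cast; linarith
  exact_mod_cast this

lemma fiber_mem (T x r : ℝ) (k : ℤ) (hr : 0 < r) (h : |x - (k + 1 / 2) * r| ≤ T * r) :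
    k ∈ Finset.Icc ⌈x / r - 1 / 2 - T⌉ ⌊x / r - 1 / 2 + T⌋ := by
  have e : x = x / r * r := by field_simp
  rw [e, ← sub_mul, abs_mul, abs_of_pos hr] at h
  have h := abs_le.1 (le_of_mul_le_mul_right h hr)
  rw [Finset.mem_Icc, Int.ceil_le, Int.le_floor]
  constructor <;> linarith [h.1, h.2]

open MeasureTheory in
lemma gen_bound (T h κ r : ℝ) (P N : ℕ) (n : ℤ) (f : ℝ × ℝ → Hei) (hκ : 0 < κ)
    (hN : 2 * T + 1 ≤ N) (hr : r = 2 ^ (-n)) (Reg : Set (ℝ × ℝ))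
    (s : Finset Idx) (hn : ∀ i ∈ s, i.1 = n)
    (hs : ∀ i ∈ s, ∃ q : Idx, q.1 = i.1 + P ∧ ∀ w ∈ rect q,
        |w.1 - (center i).1| ≤ T * sideLen i ∧ |w.2 - (center i).2| ≤ T * sideLen i ^ 2 ∧
        κ ≤ SS f (h * sideLen i) w / (h * sideLen i) ^ 2)
    (hReg : ∀ i ∈ s, ∀ w : ℝ × ℝ, |w.1 - (center i).1| ≤ T * sideLen i →
      |w.2 - (center i).2| ≤ T * sideLen i ^ 2 → w ∈ Reg) :
    ∑ i ∈ s, ENNReal.ofReal (sideLen i ^ 3) ≤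
      ENNReal.ofReal (N ^ 2 * 8 ^ P / κ) *
        ∫⁻ w in Reg, ENNReal.ofReal (SS f (h * r) w / (h * r) ^ 2) := by
  classical
  have hrpos : 0 < r := by rw [hr]; positivity
  have hsl : ∀ i ∈ s, sideLen i = r := by
    intro i hi; unfold sideLen; rw [hn i hi, hr]
  choose! φ hφ1 hφ2 using hs
  have hcard : s.card ≤ N ^ 2 * (s.image φ).card := by
    apply Finset.card_le_mul_card_image
    intro q hq
    have hsub : {i ∈ s | φ i = q} ⊆ ({n} : Finset ℤ) ×ˢ
        (Finset.Icc ⌈(center q).1 / r - 1 / 2 - T⌉ ⌊(center q).1 / r - 1 / 2 + T⌋ ×ˢ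
         Finset.Icc ⌈(center q).2 / r ^ 2 - 1 / 2 - T⌉ ⌊(center q).2 / r ^ 2 - 1 / 2 + T⌋) := by
      intro i hi
      rw [Finset.mem_filter] at hi
      obtain ⟨his, hiq⟩ := hi
      have := hφ2 i his (center q) (by rw [hiq]; exact center_mem q)
      rw [hsl i his, center_eq i, hsl i his] at this
      rw [Finset.mem_product, Finset.mem_product, Finset.mem_singleton]
      exact ⟨hn i his, fiber_mem T _ r _ hrpos this.1, fiber_mem T _ (r ^ 2) _ (by positivity) this.2.1⟩
    refine (Finset.card_le_card hsub).trans ?_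
    rw [Finset.card_product, Finset.card_product, Finset.card_singleton, one_mul]
    exact (Nat.mul_le_mul (card_Icc_le _ _ _ hN) (card_Icc_le _ _ _ hN)).trans (sq N).symm.le
  have hgen : ∀ q ∈ s.image φ, q.1 = n + P := by
    intro q hq
    obtain ⟨i, hi, rfl⟩ := Finset.mem_image.1 hq
    rw [hφ1 i hi, hn i hi]
  have hslq : ∀ q ∈ s.image φ, r ^ 3 = 8 ^ P * sideLen q ^ 3 := by
    intro q hq
    have : r = 2 ^ P * sideLen q := by
      unfold sideLen
      rw [hgen q hq, hr, neg_add, zpow_add₀ (by norm_num), zpow_neg _ (P : ℤ), zpow_natCast]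
      field_simp
    rw [this, mul_pow, ← pow_mul, mul_comm P 3, pow_mul]; norm_num
  have hint : ∀ q ∈ s.image φ, ENNReal.ofReal (r ^ 3) ≤ ENNReal.ofReal (8 ^ P / κ) *
      ∫⁻ w in rect q, ENNReal.ofReal (SS f (h * r) w / (h * r) ^ 2) := by
    intro q hq
    have h1 : ENNReal.ofReal κ * volume (rect q) ≤
        ∫⁻ w in rect q, ENNReal.ofReal (SS f (h * r) w / (h * r) ^ 2) := by
      rw [← setLIntegral_const]
      refine setLIntegral_mono' (measurableSet_rect q) ?_
      intro w hw
      obtain ⟨i, hi, rfl⟩ := Finset.mem_image.1 hq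
      have := (hφ2 i hi w hw).2.2
      rw [hsl i hi] at this
      exact ENNReal.ofReal_le_ofReal this
    refine le_trans ?_ (mul_le_mul_right h1 _)
    rw [volume_rect, ← ENNReal.ofReal_mul hκ.le, ← ENNReal.ofReal_mul (by positivity), hslq q hq]
    apply ENNReal.ofReal_le_ofReal
    apply le_of_eq
    field_simp
  have hdisj : Set.PairwiseDisjoint (↑(s.image φ)) rect := by
    intro q hq q' hq' hne
    exact rect_disjoint (by rw [hgen q hq, hgen q' hq']) hne
  calc ∑ i ∈ s, ENNReal.ofReal (sideLen i ^ 3) = ∑ i ∈ s, ENNReal.ofReal (r ^ 3) :=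
        Finset.sum_congr rfl (fun i hi => by rw [hsl i hi])
    _ = s.card * ENNReal.ofReal (r ^ 3) := by rw [Finset.sum_const, nsmul_eq_mul]
    _ ≤ (N ^ 2 * (s.image φ).card : ℕ) * ENNReal.ofReal (r ^ 3) := by gcongr
    _ = (N : ℝ≥0∞) ^ 2 * ∑ q ∈ s.image φ, ENNReal.ofReal (r ^ 3) := by
        rw [Finset.sum_const, nsmul_eq_mul]; push_cast; ring
    _ ≤ (N : ℝ≥0∞) ^ 2 * ∑ q ∈ s.image φ, (ENNReal.ofReal (8 ^ P / κ) *
          ∫⁻ w in rect q, ENNReal.ofReal (SS f (h * r) w / (h * r) ^ 2)) := by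
        gcongr with q hq; exact hint q hq
    _ = ENNReal.ofReal (N ^ 2 * 8 ^ P / κ) * ∑ q ∈ s.image φ,
          ∫⁻ w in rect q, ENNReal.ofReal (SS f (h * r) w / (h * r) ^ 2) := by
        rw [← Finset.mul_sum, ← mul_assoc]
        congr 1
        rw [mul_div_assoc, ENNReal.ofReal_mul (by positivity), ENNReal.ofReal_pow (by positivity),
          ENNReal.ofReal_natCast]
    _ = ENNReal.ofReal (N ^ 2 * 8 ^ P / κ) *
          ∫⁻ w in ⋃ q ∈ s.image φ, rect q, ENNReal.ofReal (SS f (h * r) w / (h * r) ^ 2) := by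
        rw [lintegral_biUnion_finset hdisj (fun q _ => measurableSet_rect q)]
    _ ≤ _ := by
        gcongr
        intro w hw
        rw [Set.mem_iUnion₂] at hw
        obtain ⟨q, hq, hwq⟩ := hw
        obtain ⟨i, hi, rfl⟩ := Finset.mem_image.1 hq
        have := hφ2 i hi w hwq
        exact hReg i hi w this.1 this.2.1

lemma gen_le {i i₀ : Idx} (h : rect i ⊆ rect i₀) : i₀.1 ≤ i.1 := by
  have hp := sideLen_pos i
  have hp0 := sideLen_pos i₀
  by_contra hcon
  push Not at hcon
  have hlt : 2 * sideLen i₀ ≤ sideLen i := by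
    unfold sideLen
    rw [← zpow_one_add₀ (by norm_num)]
    exact zpow_le_zpow_right₀ (by norm_num) (by omega)
  have h1 : ((i.2.1 : ℝ) * sideLen i, (i.2.2 : ℝ) * sideLen i ^ 2) ∈ rect i := by
    rw [mem_rect]
    have : 0 < sideLen i ^ 2 := by positivity
    refine ⟨⟨le_rfl, ?_⟩, le_rfl, ?_⟩ <;> simp only <;> linarith
  have h2 : (((i.2.1 : ℝ) + 1 / 2) * sideLen i, (i.2.2 : ℝ) * sideLen i ^ 2) ∈ rect i := by
    rw [mem_rect]
    have : 0 < sideLen i ^ 2 := by positivity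
    refine ⟨⟨?_, ?_⟩, le_rfl, ?_⟩ <;> simp only <;> linarith
  have h3 := (mem_rect.1 (h h1)).1.1
  have h4 := (mem_rect.1 (h h2)).1.2
  simp only at h3 h4
  linarith

open MeasureTheory in
lemma main_bound (M T h κ : ℝ) (P N : ℕ) (hM : 1 ≤ M) (hT : 1 ≤ T) (hh : 0 < h) (hκ : 0 < κ)
    (hN : 2 * T + 1 ≤ N) (f : ℝ × ℝ → Hei) (hf : IsBilipschitz M f) (i₀ : Idx)
    (s : Finset Idx) (hsub : ∀ i ∈ s, rect i ⊆ rect i₀)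
    (hs : ∀ i ∈ s, ∃ q : Idx, q.1 = i.1 + P ∧ ∀ w ∈ rect q,
        |w.1 - (center i).1| ≤ T * sideLen i ∧ |w.2 - (center i).2| ≤ T * sideLen i ^ 2 ∧
        κ ≤ SS f (h * sideLen i) w / (h * sideLen i) ^ 2) :
    ∑ i ∈ s, ENNReal.ofReal (sideLen i ^ 3) ≤
      ENNReal.ofReal (N ^ 2 * 8 ^ P / κ * (8 * M ^ 2 * (2 * (T + 1) + h) * (2 * (T + 1)))
        * sideLen i₀ ^ 3) := by
  classical
  set ℓ := sideLen i₀ with hℓ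
  have hℓpos : 0 < ℓ := sideLen_pos i₀
  set g : Idx → ℕ := fun i => (i.1 - i₀.1).toNat with hg
  set m := s.sup g + 1 with hm
  have hmaps : ∀ i ∈ s, g i ∈ Finset.range m := by
    intro i hi
    rw [Finset.mem_range, hm, Nat.lt_succ_iff]
    exact Finset.le_sup hi
  set a := (center i₀).1 with ha
  set b := (center i₀).2 with hb
  set Reg : Set (ℝ × ℝ) := Set.Icc (a - (T + 1) * ℓ) (a + (T + 1) * ℓ) ×ˢ
    Set.Icc (b - (T + 1) * ℓ ^ 2) (b + (T + 1) * ℓ ^ 2) with hReg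
  rw [← Finset.sum_fiberwise_of_maps_to hmaps]
  have hgen : ∀ j ∈ Finset.range m, ∑ i ∈ s with g i = j, ENNReal.ofReal (sideLen i ^ 3) ≤
      ENNReal.ofReal (N ^ 2 * 8 ^ P / κ) *
        ∫⁻ w in Reg, ENNReal.ofReal (SS f (h * ℓ / 2 ^ j) w / (h * ℓ / 2 ^ j) ^ 2) := by
    intro j _
    have hr : ℓ / 2 ^ j = 2 ^ (-(i₀.1 + j)) := by
      rw [hℓ]; unfold sideLen
      rw [neg_add, zpow_add₀ (by norm_num), zpow_neg _ (j : ℤ), zpow_natCast]; rfl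
    rw [mul_div_assoc h ℓ]
    apply gen_bound T h κ (ℓ / 2 ^ j) P N (i₀.1 + j) f hκ hN hr Reg
    · intro i hi
      rw [Finset.mem_filter] at hi
      have := gen_le (hsub i hi.1)
      have h2 := hi.2
      simp only [hg] at h2
      omega
    · intro i hi
      exact hs i (Finset.mem_filter.1 hi).1
    · intro i hi w h1 h2
      have his := (Finset.mem_filter.1 hi).1
      have hgl := gen_le (hsub i his)
      have hsl : sideLen i ≤ ℓ := by
        rw [hℓ]; unfold sideLen
        exact zpow_le_zpow_right₀ (by norm_num) (by omega)
      have hp := sideLen_pos i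
      have hsl2 : sideLen i ^ 2 ≤ ℓ ^ 2 := by gcongr
      have hc := mem_rect.1 (hsub i his (center_mem i))
      have hc0 := mem_rect.1 (center_mem i₀)
      rw [← hℓ] at hc hc0
      have k1 : T * sideLen i ≤ T * ℓ := by gcongr
      have k2 : T * sideLen i ^ 2 ≤ T * ℓ ^ 2 := by gcongr
      rw [abs_le] at h1 h2
      rw [hReg, Set.mem_prod, Set.mem_Icc, Set.mem_Icc]
      refine ⟨⟨?_, ?_⟩, ?_, ?_⟩
      · linarith [hc.1.1, hc0.1.2]
      · linarith [hc.1.2, hc0.1.1]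
      · linarith [hc.2.1, hc0.2.2]
      · linarith [hc.2.2, hc0.2.1]
  refine (Finset.sum_le_sum hgen).trans ?_
  rw [← Finset.mul_sum]
  have hE := energy_two hM hf (a - (T + 1) * ℓ) (a + (T + 1) * ℓ) (b - (T + 1) * ℓ ^ 2)
    (b + (T + 1) * ℓ ^ 2) (h * ℓ) (by nlinarith) (by positivity) m
  refine (mul_le_mul_right hE _).trans ?_
  have p1 : 0 ≤ 8 * M ^ 2 * (a + (T + 1) * ℓ - (a - (T + 1) * ℓ) + h * ℓ) := by
    have : a + (T + 1) * ℓ - (a - (T + 1) * ℓ) + h * ℓ = (2 * (T + 1) + h) * ℓ := by ring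
    rw [this]; positivity
  rw [← ENNReal.ofReal_mul p1, ← ENNReal.ofReal_mul (by positivity)]
  apply ENNReal.ofReal_le_ofReal
  apply le_of_eq
  ring
/-- **Corollary 3.8 (weak geometric lemma).** Carleson packing condition for the
strong vertical β-numbers. -/
theorem weak_geometric_lemma (M : ℝ) (hM : 1 ≤ M) :
    ∀ ε : ℝ, 0 < ε → ε ≤ 1 → ∀ C : ℝ, 1 ≤ C → ∃ C'' > (0 : ℝ),
      ∀ f : ℝ × ℝ → Hei, IsBilipschitz M f → ∀ i₀ : Idx,
        (∑' i : {i : Idx // rect i ⊆ rect i₀ ∧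
            ε ≤ beta f (center i) (C * sideLen i)},
          ENNReal.ofReal (sideLen i.val ^ 3)) ≤ ENNReal.ofReal (C'' * sideLen i₀ ^ 3) := by
  intro ε hε _ C hC
  obtain ⟨T, hT, h, hh, κ, hκ, P, H⟩ := bad_cell M ε C hM hε hC
  obtain ⟨N, hN⟩ := exists_nat_ge (2 * T + 1)
  have hN0 : (0 : ℝ) < N := by linarith
  refine ⟨N ^ 2 * 8 ^ P / κ * (8 * M ^ 2 * (2 * (T + 1) + h) * (2 * (T + 1))), by positivity, ?_⟩
  intro f hf i₀
  rw [ENNReal.tsum_eq_iSup_sum]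
  refine iSup_le ?_
  intro s
  have := main_bound M T h κ P N hM hT hh hκ hN f hf i₀ (s.map (Function.Embedding.subtype _))
    (by
      intro i hi
      rw [Finset.mem_map] at hi
      obtain ⟨j, _, rfl⟩ := hi
      exact j.2.1)
    (by
      intro i hi
      rw [Finset.mem_map] at hi
      obtain ⟨j, _, rfl⟩ := hi
      exact H f hf _ j.2.2)
  rw [Finset.sum_map] at this
  exact this

end HeisRug
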